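/- arXiv:1412.2560 — 2 statements merged into one kernel-verified Lean document; each statement's English description precedes it below -/
import Mathlib

section
/- Let Ω ⊆ ℝ⁴ be an open set, K ⊆ Ω a compact set, and A > 0. There exists a constant c > 0, depending only on A, K and Ω, such that for every measurable function h : Ω → ℝ with |h(x)| ≤ A for all x ∈ Ω and every positive C² function u : Ω → ℝ satisfying −Δu + h·u = 8u³ on Ω, one has (sup_{x ∈ K} u(x))^{1/3} · (inf_{x ∈ Ω} u(x)) ≤ c. -/
/-- The Euclidean Laplacian on ℝ⁴: `Δu(x) = ∑ i, ∂²u/∂x_i²`. -/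
noncomputable def lap (u : EuclideanSpace ℝ (Fin 4) → ℝ) (x : EuclideanSpace ℝ (Fin 4)) : ℝ :=
  ∑ i : Fin 4, fderiv ℝ (fun y => fderiv ℝ u y (EuclideanSpace.single i 1)) x
    (EuclideanSpace.single i 1)

open Filter Topology Metric

lemma hasDerivAt_line {V : Type*} [NormedAddCommGroup V] [NormedSpace ℝ V] (y v : V) (t : ℝ) :
    HasDerivAt (fun s : ℝ => y + s • v) v t := by
  simpa using ((hasDerivAt_id t).smul_const v).const_add y

lemma eventually_line {V : Type*} [NormedAddCommGroup V] [NormedSpace ℝ V] {y : V} (v : V)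
    {P : V → Prop} (h : ∀ᶠ z in 𝓝 y, P z) : ∀ᶠ t : ℝ in 𝓝 0, P (y + t • v) := by
  have hc : Tendsto (fun t : ℝ => y + t • v) (𝓝 0) (𝓝 y) := by
    simpa using (hasDerivAt_line y v 0).continuousAt.tendsto
  exact hc.eventually h

lemma ContDiffAt.hasFDerivAt_fderiv {V : Type*} [NormedAddCommGroup V] [NormedSpace ℝ V]
    {f : V → ℝ} {y : V} (hf : ContDiffAt ℝ 2 f y) :
    HasFDerivAt (fderiv ℝ f) (fderiv ℝ (fderiv ℝ f) y) y :=
  ((hf.fderiv_right (m := 1) (by norm_num)).differentiableAt (by norm_num)).hasFDerivAt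

lemma ContDiffAt.eventually_hasFDerivAt {V : Type*} [NormedAddCommGroup V] [NormedSpace ℝ V]
    {f : V → ℝ} {y : V} (hf : ContDiffAt ℝ 2 f y) :
    ∀ᶠ z in 𝓝 y, HasFDerivAt f (fderiv ℝ f z) z :=
  (hf.eventually (by norm_num)).mono fun _ hz => (hz.differentiableAt (by norm_num)).hasFDerivAt

lemma ContDiffAt.eventually_hasDerivAt_line {V : Type*} [NormedAddCommGroup V] [NormedSpace ℝ V]
    {f : V → ℝ} {y : V} (hf : ContDiffAt ℝ 2 f y) (v : V) :
    ∀ᶠ t in 𝓝 (0 : ℝ),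
      HasDerivAt (fun t : ℝ => f (y + t • v)) (fderiv ℝ f (y + t • v) v) t :=
  (eventually_line v hf.eventually_hasFDerivAt).mono fun t ht =>
    ht.comp_hasDerivAt t (hasDerivAt_line y v t)

lemma ContDiffAt.hasDerivAt_fderiv_line {V : Type*} [NormedAddCommGroup V] [NormedSpace ℝ V]
    {f : V → ℝ} {y : V} (hf : ContDiffAt ℝ 2 f y) (v : V) :
    HasDerivAt (fun t : ℝ => fderiv ℝ f (y + t • v) v) (fderiv ℝ (fderiv ℝ f) y v v) 0 := by
  have h : HasFDerivAt (fderiv ℝ f) (fderiv ℝ (fderiv ℝ f) y) (y + (0 : ℝ) • v) := by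
    simpa using hf.hasFDerivAt_fderiv
  exact (ContinuousLinearMap.apply ℝ ℝ v).hasFDerivAt.comp_hasDerivAt (0 : ℝ)
    (h.comp_hasDerivAt (0 : ℝ) (hasDerivAt_line y v 0))

lemma lap_eq_sum {f : EuclideanSpace ℝ (Fin 4) → ℝ} {y : EuclideanSpace ℝ (Fin 4)}
    (hf : ContDiffAt ℝ 2 f y) :
    lap f y = ∑ i : Fin 4, fderiv ℝ (fderiv ℝ f) y (EuclideanSpace.single i 1)
      (EuclideanSpace.single i 1) := by
  refine Finset.sum_congr rfl fun i _ => ?_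
  rw [(hf.hasFDerivAt_fderiv.clm_apply (hasFDerivAt_const _ y)).fderiv]
  simp

lemma lap_eq_of_hasDerivAt {f : EuclideanSpace ℝ (Fin 4) → ℝ} {y : EuclideanSpace ℝ (Fin 4)}
    (hf : ContDiffAt ℝ 2 f y) {g : Fin 4 → ℝ → ℝ} {c : Fin 4 → ℝ}
    (hg : ∀ i, ∀ᶠ t in 𝓝 (0 : ℝ),
      HasDerivAt (fun t : ℝ => f (y + t • EuclideanSpace.single i 1)) (g i t) t)
    (hc : ∀ i, HasDerivAt (g i) (c i) 0) :
    lap f y = ∑ i, c i := by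
  rw [lap_eq_sum hf]
  refine Finset.sum_congr rfl fun i _ => ?_
  refine (hf.hasDerivAt_fderiv_line _).unique ((hc i).congr_of_eventuallyEq ?_)
  filter_upwards [hg i, hf.eventually_hasDerivAt_line (EuclideanSpace.single i 1)] with t h1 h2
  exact h2.unique h1

lemma lap_add {f g : EuclideanSpace ℝ (Fin 4) → ℝ} {y : EuclideanSpace ℝ (Fin 4)}
    (hf : ContDiffAt ℝ 2 f y) (hg : ContDiffAt ℝ 2 g y) :
    lap (fun z => f z + g z) y = lap f y + lap g y := by
  rw [lap_eq_sum hf, lap_eq_sum hg, ← Finset.sum_add_distrib]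
  refine lap_eq_of_hasDerivAt (hf.add hg) (fun i => ?_) (fun i =>
    (hf.hasDerivAt_fderiv_line _).add (hg.hasDerivAt_fderiv_line _))
  filter_upwards [hf.eventually_hasDerivAt_line (EuclideanSpace.single i 1),
    hg.eventually_hasDerivAt_line (EuclideanSpace.single i 1)] with t h1 h2
  exact h1.add h2

lemma lap_sub {f g : EuclideanSpace ℝ (Fin 4) → ℝ} {y : EuclideanSpace ℝ (Fin 4)}
    (hf : ContDiffAt ℝ 2 f y) (hg : ContDiffAt ℝ 2 g y) :
    lap (fun z => f z - g z) y = lap f y - lap g y := by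
  rw [lap_eq_sum hf, lap_eq_sum hg, ← Finset.sum_sub_distrib]
  refine lap_eq_of_hasDerivAt (hf.sub hg) (fun i => ?_) (fun i =>
    (hf.hasDerivAt_fderiv_line _).sub (hg.hasDerivAt_fderiv_line _))
  filter_upwards [hf.eventually_hasDerivAt_line (EuclideanSpace.single i 1),
    hg.eventually_hasDerivAt_line (EuclideanSpace.single i 1)] with t h1 h2
  exact h1.sub h2

lemma lap_const_mul (c : ℝ) {f : EuclideanSpace ℝ (Fin 4) → ℝ} {y : EuclideanSpace ℝ (Fin 4)}
    (hf : ContDiffAt ℝ 2 f y) :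
    lap (fun z => c * f z) y = c * lap f y := by
  rw [lap_eq_sum hf, Finset.mul_sum]
  exact lap_eq_of_hasDerivAt (contDiffAt_const.mul hf)
    (fun i => (hf.eventually_hasDerivAt_line (EuclideanSpace.single i 1)).mono
      fun t ht => ht.const_mul c)
    (fun i => (hf.hasDerivAt_fderiv_line _).const_mul c)

lemma lap_const (c : ℝ) (y : EuclideanSpace ℝ (Fin 4)) : lap (fun _ => c) y = 0 := by
  simp [lap]

lemma lap_comp_add_left (u : EuclideanSpace ℝ (Fin 4) → ℝ) (x y : EuclideanSpace ℝ (Fin 4)) :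
    lap (fun z => u (x + z)) y = lap u (x + y) := by
  unfold lap
  refine Finset.sum_congr rfl fun i _ => ?_
  simp only [fderiv_comp_add_left]
  rw [fderiv_comp_add_left (f := fun y => fderiv ℝ u y (EuclideanSpace.single i 1))]

lemma sum_sq_eq (y : EuclideanSpace ℝ (Fin 4)) : ∑ i, y i ^ 2 = ‖y‖ ^ 2 := by
  rw [EuclideanSpace.norm_sq_eq]; simp

lemma sum_mul_apply_single (y : EuclideanSpace ℝ (Fin 4))
    (L : EuclideanSpace ℝ (Fin 4) →L[ℝ] ℝ) :
    ∑ i, y i * L (EuclideanSpace.single i 1) = L y := by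
  have h : y = ∑ i, y i • EuclideanSpace.single i (1 : ℝ) := by
    ext j; simp [Finset.sum_apply, Pi.single_apply]
  conv_rhs => rw [h]
  simp

lemma hasDerivAt_norm_sq_line (y v : EuclideanSpace ℝ (Fin 4)) (t : ℝ) :
    HasDerivAt (fun s : ℝ => ‖y + s • v‖ ^ 2) (2 * inner ℝ (y + t • v) v) t :=
  (hasDerivAt_line y v t).norm_sq

lemma hasDerivAt_inner_line (y v : EuclideanSpace ℝ (Fin 4)) (t : ℝ) :
    HasDerivAt (fun s : ℝ => inner ℝ (y + s • v) v) (‖v‖ ^ 2) t := by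
  have := (hasDerivAt_line y v t).inner ℝ (hasDerivAt_const t v)
  simpa using this

lemma lap_norm_sq (y : EuclideanSpace ℝ (Fin 4)) :
    lap (fun z => ‖z‖ ^ 2) y = 8 := by
  rw [lap_eq_of_hasDerivAt (contDiff_norm_sq ℝ).contDiffAt
    (fun i => Eventually.of_forall fun t => hasDerivAt_norm_sq_line y _ t)
    (fun i => (hasDerivAt_inner_line y _ 0).const_mul 2)]
  simp; norm_num

lemma hasDerivAt_norm_inv_line (y v : EuclideanSpace ℝ (Fin 4)) (t : ℝ) (h : y + t • v ≠ 0) :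
    HasDerivAt (fun s : ℝ => ‖y + s • v‖⁻¹)
      (-(‖y + t • v‖⁻¹ ^ 3 * inner ℝ (y + t • v) v)) t := by
  have h' : ‖y + t • v‖ ≠ 0 := norm_ne_zero_iff.2 h
  have := ((hasDerivAt_norm_sq_line y v t).sqrt (by positivity)).inv
    (by rw [Real.sqrt_sq (norm_nonneg _)]; exact h')
  simp only [Real.sqrt_sq (norm_nonneg _)] at this
  refine this.congr_deriv ?_
  field_simp

lemma lap_norm_inv {y : EuclideanSpace ℝ (Fin 4)} (hy : y ≠ 0) :
    lap (fun z => ‖z‖⁻¹) y = -(‖y‖⁻¹ ^ 3) := by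
  have hy' : ‖y‖ ≠ 0 := norm_ne_zero_iff.2 hy
  have hne : ∀ v : EuclideanSpace ℝ (Fin 4), ∀ᶠ t : ℝ in 𝓝 0, y + t • v ≠ 0 :=
    fun v => eventually_line v (isOpen_ne.mem_nhds hy)
  rw [lap_eq_of_hasDerivAt (f := fun z => ‖z‖⁻¹) ((contDiffAt_norm ℝ hy).inv hy')
    (fun i => (hne _).mono fun t ht => hasDerivAt_norm_inv_line y _ t ht)
    (fun i => (((hasDerivAt_norm_inv_line y _ 0 (by simpa using hy)).pow 3).mul (hasDerivAt_inner_line y _ 0)).neg)]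
  simp only [zero_smul, add_zero, PiLp.norm_single, norm_one,
    EuclideanSpace.inner_single_right]
  have h4 := sum_sq_eq y
  simp only [Fin.sum_univ_four] at h4 ⊢
  simp
  field_simp
  linear_combination 3 * h4

/-- The Kelvin transform of `u` on `ℝ⁴` with respect to the sphere of radius `√k`. -/
noncomputable def kelvin (k : ℝ) (u : EuclideanSpace ℝ (Fin 4) → ℝ)
    (y : EuclideanSpace ℝ (Fin 4)) : ℝ :=
  k * (‖y‖ ^ 2)⁻¹ * u ((k * (‖y‖ ^ 2)⁻¹) • y)

lemma contDiffAt_kelvin_factor (k : ℝ) {y : EuclideanSpace ℝ (Fin 4)} (hy : y ≠ 0) :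
    ContDiffAt ℝ 2 (fun z : EuclideanSpace ℝ (Fin 4) => k * (‖z‖ ^ 2)⁻¹) y :=
  contDiffAt_const.mul ((contDiff_norm_sq ℝ).contDiffAt.inv
    (pow_ne_zero 2 (norm_ne_zero_iff.2 hy)))

lemma contDiffAt_kelvin {k : ℝ} {u : EuclideanSpace ℝ (Fin 4) → ℝ}
    {y : EuclideanSpace ℝ (Fin 4)} (hy : y ≠ 0)
    (hu : ContDiffAt ℝ 2 u ((k * (‖y‖ ^ 2)⁻¹) • y)) :
    ContDiffAt ℝ 2 (kelvin k u) y :=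
  (contDiffAt_kelvin_factor k hy).mul
    (ContDiffAt.comp y hu ((contDiffAt_kelvin_factor k hy).smul contDiffAt_id))

lemma hasDerivAt_kelvin_factor_line (k : ℝ) (y v : EuclideanSpace ℝ (Fin 4)) (t : ℝ)
    (h : y + t • v ≠ 0) :
    HasDerivAt (fun s : ℝ => k * (‖y + s • v‖ ^ 2)⁻¹)
      (-(2 * k) * (((‖y + t • v‖ ^ 2)⁻¹) ^ 2 * inner ℝ (y + t • v) v)) t := by
  have h' : ‖y + t • v‖ ≠ 0 := norm_ne_zero_iff.2 h
  refine (((hasDerivAt_norm_sq_line y v t).inv (pow_ne_zero 2 h')).const_mul k).congr_deriv ?_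
  field_simp

lemma lap_kelvin {k : ℝ} {u : EuclideanSpace ℝ (Fin 4) → ℝ}
    {y : EuclideanSpace ℝ (Fin 4)} (hy : y ≠ 0)
    (hu : ContDiffAt ℝ 2 u ((k * (‖y‖ ^ 2)⁻¹) • y)) :
    lap (kelvin k u) y = (k * (‖y‖ ^ 2)⁻¹) ^ 3 * lap u ((k * (‖y‖ ^ 2)⁻¹) • y) := by
  have hy' : ‖y‖ ≠ 0 := norm_ne_zero_iff.2 hy
  have hne : ∀ v : EuclideanSpace ℝ (Fin 4), ∀ᶠ t : ℝ in 𝓝 0, y + t • v ≠ 0 :=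
    fun v => eventually_line v (isOpen_ne.mem_nhds hy)
  let p : EuclideanSpace ℝ (Fin 4) → ℝ → ℝ := fun v t => k * (‖y + t • v‖ ^ 2)⁻¹
  let p₁ : EuclideanSpace ℝ (Fin 4) → ℝ → ℝ := fun v t =>
    -(2 * k) * (((‖y + t • v‖ ^ 2)⁻¹) ^ 2 * inner ℝ (y + t • v) v)
  let p₂ : EuclideanSpace ℝ (Fin 4) → ℝ := fun v =>
    8 * k * inner ℝ y v ^ 2 * (‖y‖ ^ 2)⁻¹ ^ 3 - 2 * k * ‖v‖ ^ 2 * (‖y‖ ^ 2)⁻¹ ^ 2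
  have hp : ∀ v t, y + t • v ≠ 0 → HasDerivAt (p v) (p₁ v t) t := fun v t h =>
    hasDerivAt_kelvin_factor_line k y v t h
  have hp₁ : ∀ v, HasDerivAt (p₁ v) (p₂ v) 0 := by
    intro v
    have h0 := hasDerivAt_kelvin_factor_line 1 y v 0 (by simpa using hy)
    simp only [one_mul] at h0
    refine (((h0.pow 2).mul (hasDerivAt_inner_line y v 0)).const_mul (-(2 * k))).congr_deriv ?_
    simp only [p₂, zero_smul, add_zero, mul_one, Pi.pow_apply]
    push_cast
    ring
  let γ : EuclideanSpace ℝ (Fin 4) → ℝ → EuclideanSpace ℝ (Fin 4) := fun v t =>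
    p v t • (y + t • v)
  let γ₁ : EuclideanSpace ℝ (Fin 4) → ℝ → EuclideanSpace ℝ (Fin 4) := fun v t =>
    p v t • v + p₁ v t • (y + t • v)
  have hγ : ∀ v t, y + t • v ≠ 0 → HasDerivAt (γ v) (γ₁ v t) t := fun v t h =>
    (hp v t h).smul (hasDerivAt_line y v t)
  have hp0 : ∀ v, p v 0 = k * (‖y‖ ^ 2)⁻¹ := fun v => by simp [p]
  have hγ0 : ∀ v, γ v 0 = (k * (‖y‖ ^ 2)⁻¹) • y := fun v => by simp [γ, p]
  have h0 : ∀ v : EuclideanSpace ℝ (Fin 4), y + (0 : ℝ) • v ≠ 0 := fun v => by simpa using hy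
  have hγ₁ : ∀ v, HasDerivAt (γ₁ v)
      (p₁ v 0 • v + (p₁ v 0 • v + p₂ v • (y + (0 : ℝ) • v))) 0 := fun v =>
    ((hp v 0 (h0 v)).smul_const v).add ((hp₁ v).smul (hasDerivAt_line y v 0))
  set z := (k * (‖y‖ ^ 2)⁻¹) • y with hz
  have huγ : ∀ v, ∀ᶠ t in 𝓝 (0 : ℝ),
      HasDerivAt (fun t => u (γ v t)) (fderiv ℝ u (γ v t) (γ₁ v t)) t := by
    intro v
    have hc : Tendsto (γ v) (𝓝 0) (𝓝 z) := by
      rw [← hγ0 v]; exact (hγ v 0 (h0 v)).continuousAt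
    filter_upwards [hc.eventually hu.eventually_hasFDerivAt, hne v] with t h1 h2
    exact h1.comp_hasDerivAt t (hγ v t h2)
  have hDu : ∀ v, HasDerivAt (fun t => fderiv ℝ u (γ v t) (γ₁ v t))
      (fderiv ℝ (fderiv ℝ u) z (γ₁ v 0) (γ₁ v 0) +
        fderiv ℝ u z (p₁ v 0 • v + (p₁ v 0 • v + p₂ v • (y + (0 : ℝ) • v)))) 0 := by
    intro v
    have h1 : HasFDerivAt (fderiv ℝ u) (fderiv ℝ (fderiv ℝ u) z) (γ v 0) := by
      rw [hγ0]; exact hu.hasFDerivAt_fderiv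
    have h2 : HasDerivAt (fun t => fderiv ℝ u (γ v t)) (fderiv ℝ (fderiv ℝ u) z (γ₁ v 0)) 0 :=
      h1.comp_hasDerivAt (0 : ℝ) (hγ v 0 (h0 v))
    have h3 := h2.clm_apply (hγ₁ v)
    rwa [hγ0] at h3
  rw [lap_eq_sum hu, lap_eq_of_hasDerivAt (contDiffAt_kelvin hy hu)
    (fun i => by
      filter_upwards [huγ (EuclideanSpace.single i 1), hne (EuclideanSpace.single i 1)]
        with t h1 h2
      exact (hp _ t h2).mul h1)
    (fun i => ((hp₁ _).mul (huγ _).self_of_nhds).add ((hp _ 0 (h0 _)).mul (hDu _)))]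
  simp only [hγ0]
  set L := fderiv ℝ u z
  set B := fderiv ℝ (fderiv ℝ u) z
  simp only [γ₁, p₁, p₂, hp0, zero_smul, add_zero, PiLp.norm_single, norm_one,
    EuclideanSpace.inner_single_right, map_add, map_smul, add_apply,
    smul_apply, smul_eq_mul, one_mul, conj_trivial]
  have e1 := sum_sq_eq y
  have e2 := sum_mul_apply_single y L
  have e3 := sum_mul_apply_single y (B y)
  have e4 : ∑ i, y i * B (EuclideanSpace.single i 1) y = B y y :=
    sum_mul_apply_single y (B.flip y)
  obtain ⟨q, hq⟩ : ∃ q : ℝ, q = (‖y‖ ^ 2)⁻¹ := ⟨_, rfl⟩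
  have hq1 : q * ‖y‖ ^ 2 = 1 := by rw [hq]; field_simp
  rw [← hq]
  simp only [Fin.sum_univ_four] at e1 e2 e3 e4 ⊢
  rw [← e1] at hq1
  linear_combination 8 * k * q ^ 2 * u z * hq1 - 8 * k ^ 2 * q ^ 3 * e2
    + 16 * k ^ 2 * q ^ 3 * L y * hq1 - 2 * k ^ 3 * q ^ 4 * e3 - 2 * k ^ 3 * q ^ 4 * e4
    + 4 * k ^ 3 * q ^ 4 * B y y * hq1

lemma nonneg_of_hasDerivAt_of_eventually {g : ℝ → ℝ} {d : ℝ} (hg : HasDerivAt g d 0)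
    (h0 : g 0 = 0) (hpos : ∀ᶠ t in 𝓝[>] (0 : ℝ), 0 ≤ g t) : 0 ≤ d := by
  by_contra! hd
  have h : Tendsto (slope g 0) (𝓝[>] 0) (𝓝 d) := (hasDerivAt_iff_tendsto_slope.1 hg).mono_left
    (nhdsWithin_mono _ fun t (ht : 0 < t) => ht.ne')
  have h1 := h.eventually (gt_mem_nhds hd)
  obtain ⟨t, ht1, ht2, ht3⟩ := (h1.and (hpos.and self_mem_nhdsWithin)).exists
  have ht3' : (0 : ℝ) < t := ht3
  rw [slope_def_field, h0, sub_zero, sub_zero] at ht1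
  exact absurd ht1 (not_lt.2 (by positivity))

lemma nonneg_second_deriv_of_eventually {g g' : ℝ → ℝ} {d : ℝ}
    (hg : ∀ᶠ t in 𝓝 (0 : ℝ), HasDerivAt g (g' t) t) (hg' : HasDerivAt g' d 0)
    (h0 : g 0 = 0) (h1 : g' 0 = 0) (hpos : ∀ᶠ t in 𝓝[>] (0 : ℝ), 0 ≤ g t) : 0 ≤ d := by
  by_contra! hd
  have h : Tendsto (slope g' 0) (𝓝[>] 0) (𝓝 d) := (hasDerivAt_iff_tendsto_slope.1 hg').mono_left
    (nhdsWithin_mono _ fun t (ht : 0 < t) => ht.ne')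
  have h2 : ∀ᶠ t in 𝓝[>] (0 : ℝ), g' t < 0 := by
    filter_upwards [h.eventually (gt_mem_nhds hd), self_mem_nhdsWithin] with t ht1 ht2
    have ht2' : (0 : ℝ) < t := ht2
    rw [slope_def_field, h1, sub_zero, sub_zero] at ht1
    by_contra! hc
    exact absurd ht1 (not_lt.2 (by positivity))
  obtain ⟨ε, hε, hε'⟩ := mem_nhdsGT_iff_exists_Ioo_subset.1
    (h2.and (hpos.and (hg.filter_mono nhdsWithin_le_nhds)))
  have hε0 : (0 : ℝ) < ε := hε
  have hg0 : HasDerivAt g (g' 0) 0 := hg.self_of_nhds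
  obtain ⟨c, hc, hc'⟩ := exists_hasDerivAt_eq_slope g g' (a := 0) (b := ε / 2) (by linarith)
    (fun t ht => by
      rcases eq_or_lt_of_le ht.1 with h | h
      · rw [← h]; exact hg0.continuousAt.continuousWithinAt
      · exact (hε' ⟨h, by linarith [ht.2]⟩).2.2.continuousAt.continuousWithinAt)
    (fun t ht => (hε' ⟨ht.1, by linarith [ht.2]⟩).2.2)
  have hc1 := (hε' (⟨hc.1, by linarith [hc.2]⟩ : c ∈ Set.Ioo 0 ε)).1
  have hc2 := (hε' (⟨by linarith, by linarith⟩ : ε / 2 ∈ Set.Ioo 0 ε)).2.1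
  rw [hc', h0, sub_zero, sub_zero] at hc1
  exact absurd hc1 (not_lt.2 (by positivity))

/-- A `C²` function vanishing at `y`, nonnegative near `y` outside the ball of radius `‖y‖`
and with nonpositive radial derivative at `y`, has nonnegative Laplacian at `y`. -/
lemma lap_nonneg_of_touching {F : EuclideanSpace ℝ (Fin 4) → ℝ}
    {y : EuclideanSpace ℝ (Fin 4)} (hF : ContDiffAt ℝ 2 F y) (hy : y ≠ 0) (h0 : F y = 0)
    (hrad : fderiv ℝ F y y ≤ 0) (hpos : ∀ᶠ z in 𝓝 y, ‖y‖ ≤ ‖z‖ → 0 ≤ F z) :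
    0 ≤ lap F y := by
  have hside : ∀ v : EuclideanSpace ℝ (Fin 4), 0 ≤ inner ℝ y v →
      ∀ᶠ t in 𝓝[>] (0 : ℝ), 0 ≤ F (y + t • v) := by
    intro v hv
    filter_upwards [(eventually_line v hpos).filter_mono nhdsWithin_le_nhds,
      self_mem_nhdsWithin] with t ht1 ht2
    have ht2' : (0 : ℝ) < t := ht2
    refine ht1 (le_of_sq_le_sq ?_ (norm_nonneg _))
    rw [norm_add_sq_real, inner_smul_right]
    nlinarith [mul_nonneg ht2'.le hv, sq_nonneg ‖t • v‖]
  have hd : ∀ v : EuclideanSpace ℝ (Fin 4), 0 ≤ inner ℝ y v → 0 ≤ fderiv ℝ F y v := by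
    intro v hv
    have h := (hF.eventually_hasDerivAt_line v).self_of_nhds
    rw [zero_smul, add_zero] at h
    exact nonneg_of_hasDerivAt_of_eventually h (by simpa using h0) (hside v hv)
  have hyy : 0 < inner ℝ y y := real_inner_self_pos.2 hy
  have hy0 : fderiv ℝ F y y = 0 := le_antisymm hrad (hd y hyy.le)
  have hgrad : ∀ v, fderiv ℝ F y v = 0 := by
    intro v
    have hw : inner ℝ y (v - (inner ℝ y v / inner ℝ y y) • y) = 0 := by
      rw [inner_sub_right, inner_smul_right]; field_simp; simp
    have h1 := hd _ hw.ge
    have h2 := hd (-(v - (inner ℝ y v / inner ℝ y y) • y)) (by rw [inner_neg_right, hw, neg_zero])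
    rw [map_neg] at h2
    rw [map_sub, map_smul, hy0] at h1 h2
    simp at h1 h2
    linarith
  have h2 : ∀ v : EuclideanSpace ℝ (Fin 4), 0 ≤ inner ℝ y v →
      0 ≤ fderiv ℝ (fderiv ℝ F) y v v := fun v hv =>
    nonneg_second_deriv_of_eventually (hF.eventually_hasDerivAt_line v)
      (hF.hasDerivAt_fderiv_line v) (by simpa using h0) (by simp [hgrad]) (hside v hv)
  rw [lap_eq_sum hF]
  refine Finset.sum_nonneg fun i _ => ?_
  rcases le_total 0 (inner ℝ y (EuclideanSpace.single i (1 : ℝ))) with h | h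
  · exact h2 _ h
  · simpa using h2 (-EuclideanSpace.single i (1 : ℝ)) (by rw [inner_neg_right]; linarith)

/-- A radial function vanishing on the sphere of radius `l`, strictly subharmonic outside it. -/
noncomputable def barrier (a b l : ℝ) (y : EuclideanSpace ℝ (Fin 4)) : ℝ :=
  a * (1 - l * ‖y‖⁻¹) + b * (‖y‖ ^ 2 - l ^ 2)

lemma contDiffAt_barrier (a b l : ℝ) {y : EuclideanSpace ℝ (Fin 4)} (hy : y ≠ 0) :
    ContDiffAt ℝ 2 (barrier a b l) y :=
  (contDiffAt_const.mul (contDiffAt_const.sub (contDiffAt_const.mul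
    ((contDiffAt_norm ℝ hy).inv (norm_ne_zero_iff.2 hy))))).add
    (contDiffAt_const.mul ((contDiff_norm_sq ℝ).contDiffAt.sub contDiffAt_const))

lemma lap_barrier (a b l : ℝ) {y : EuclideanSpace ℝ (Fin 4)} (hy : y ≠ 0) :
    lap (barrier a b l) y = a * l * ‖y‖⁻¹ ^ 3 + 8 * b := by
  have h1 : ContDiffAt ℝ 2 (fun z : EuclideanSpace ℝ (Fin 4) => ‖z‖⁻¹) y :=
    (contDiffAt_norm ℝ hy).inv (norm_ne_zero_iff.2 hy)
  have h2 : ContDiffAt ℝ 2 (fun z : EuclideanSpace ℝ (Fin 4) => ‖z‖ ^ 2) y :=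
    (contDiff_norm_sq ℝ).contDiffAt
  have e : barrier a b l = fun z => (-(a * l) * ‖z‖⁻¹ + b * ‖z‖ ^ 2) + (a - b * l ^ 2) := by
    funext z; simp only [barrier]; ring
  rw [e, lap_add ((contDiffAt_const.mul h1).add (contDiffAt_const.mul h2)) contDiffAt_const,
    lap_add (contDiffAt_const.mul h1) (contDiffAt_const.mul h2), lap_const_mul _ h1,
    lap_const_mul _ h2, lap_const, lap_norm_inv hy, lap_norm_sq]
  ring

lemma barrier_nonneg {a b l : ℝ} (ha : 0 ≤ a) (hb : 0 ≤ b) (hl : 0 < l)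
    {y : EuclideanSpace ℝ (Fin 4)} (hy : l ≤ ‖y‖) : 0 ≤ barrier a b l y := by
  have h1 : l * ‖y‖⁻¹ ≤ 1 := by
    rw [← div_eq_mul_inv]; exact (div_le_one (hl.trans_le hy)).2 hy
  have h2 : l ^ 2 ≤ ‖y‖ ^ 2 := by gcongr
  exact add_nonneg (mul_nonneg ha (by linarith)) (mul_nonneg hb (by linarith))

lemma barrier_le {a b l ρ : ℝ} (ha : 0 ≤ a) (hb : 0 ≤ b) (hl : 0 ≤ l)
    {y : EuclideanSpace ℝ (Fin 4)} (hy : ‖y‖ ≤ ρ) : barrier a b l y ≤ a + b * ρ ^ 2 := by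
  have h1 : 0 ≤ l * ‖y‖⁻¹ := by positivity
  have h2 : ‖y‖ ^ 2 ≤ ρ ^ 2 := by gcongr
  unfold barrier
  have h3 := mul_nonneg ha h1
  have h4 := mul_le_mul_of_nonneg_left h2 hb
  have h5 := mul_nonneg hb (sq_nonneg l)
  linarith

lemma kelvin_add_barrier_of_norm_eq {u : EuclideanSpace ℝ (Fin 4) → ℝ} {a b l : ℝ} (hl : 0 < l)
    {y : EuclideanSpace ℝ (Fin 4)} (hy : ‖y‖ = l) :
    kelvin (l ^ 2) u y + barrier a b l y = u y := by
  have h : l ^ 2 * (l ^ 2)⁻¹ = 1 := mul_inv_cancel₀ (by positivity)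
  have h' : l * l⁻¹ = 1 := mul_inv_cancel₀ (by positivity)
  simp [kelvin, barrier, hy, h, h']

lemma sq_mul_inv_sq_le_one {l r : ℝ} (hl : 0 < l) (hr : l ≤ r) : l ^ 2 * (r ^ 2)⁻¹ ≤ 1 := by
  have : 0 < r := hl.trans_le hr
  rw [← div_eq_mul_inv]
  exact (div_le_one (by positivity)).2 (by gcongr)

lemma norm_inversion_le {l : ℝ} (hl : 0 < l) {y : EuclideanSpace ℝ (Fin 4)} (hy : l ≤ ‖y‖) :
    ‖(l ^ 2 * (‖y‖ ^ 2)⁻¹) • y‖ ≤ l := by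
  have h : 0 < ‖y‖ := hl.trans_le hy
  rw [norm_smul, Real.norm_of_nonneg (by positivity)]
  have : l ^ 2 * (‖y‖ ^ 2)⁻¹ * ‖y‖ = l * (l / ‖y‖) := by field_simp
  rw [this]
  have h2 : l / ‖y‖ ≤ 1 := (div_le_one h).2 hy
  nlinarith

lemma kelvin_add_barrier_le_of_ray {u : EuclideanSpace ℝ (Fin 4) → ℝ} {a b c l : ℝ}
    {y : EuclideanSpace ℝ (Fin 4)} (hl : 0 < l) (hy : l ≤ ‖y‖)
    (hd : ∀ t ∈ Set.Icc (l ^ 2 * (‖y‖ ^ 2)⁻¹) 1, DifferentiableAt ℝ u (t • y))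
    (hc : ∀ t ∈ Set.Icc (l ^ 2 * (‖y‖ ^ 2)⁻¹) 1, c ≤ u (t • y) + fderiv ℝ u (t • y) (t • y))
    (habc : a * ‖y‖ + b * ‖y‖ ^ 2 * (‖y‖ + l) ≤ c * (‖y‖ + l)) :
    kelvin (l ^ 2) u y + barrier a b l y ≤ u y := by
  have hr : 0 < ‖y‖ := hl.trans_le hy
  set s := l ^ 2 * (‖y‖ ^ 2)⁻¹ with hs
  have hs1 : s ≤ 1 := sq_mul_inv_sq_le_one hl hy
  have hder : ∀ t ∈ Set.Icc s 1, HasDerivAt (fun t : ℝ => t * u (t • y))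
      (u (t • y) + fderiv ℝ u (t • y) (t • y)) t := by
    intro t ht
    have h1 : HasDerivAt (fun t : ℝ => t • y) y t := by
      simpa using (hasDerivAt_id t).smul_const y
    refine ((hasDerivAt_id t).mul ((hd t ht).hasFDerivAt.comp_hasDerivAt t h1)).congr_deriv ?_
    simp
  have hmvt := (convex_Icc s 1).mul_sub_le_image_sub_of_le_deriv
    (f := fun t : ℝ => t * u (t • y))
    (fun t ht => (hder t ht).continuousAt.continuousWithinAt)
    (fun t ht => (hder t (interior_subset ht)).differentiableAt.differentiableWithinAt)
    (fun t ht => by rw [(hder t (interior_subset ht)).deriv]; exact hc t (interior_subset ht))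
    s ⟨le_rfl, hs1⟩ 1 ⟨hs1, le_rfl⟩ hs1
  simp only [one_smul, one_mul] at hmvt
  have hk : kelvin (l ^ 2) u y = s * u (s • y) := rfl
  have hb : barrier a b l y ≤ c * (1 - s) := by
    have e1 : barrier a b l y = (‖y‖ - l) * (a * ‖y‖ + b * ‖y‖ ^ 2 * (‖y‖ + l)) / ‖y‖ ^ 2 := by
      unfold barrier; field_simp; ring
    have e2 : c * (1 - s) = (‖y‖ - l) * (c * (‖y‖ + l)) / ‖y‖ ^ 2 := by
      rw [hs]; field_simp; ring
    rw [e1, e2]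
    have : 0 ≤ ‖y‖ - l := by linarith
    gcongr
  linarith

lemma fderiv_sub_kelvin_sub_barrier_radial {u : EuclideanSpace ℝ (Fin 4) → ℝ} {a b l : ℝ}
    {y : EuclideanSpace ℝ (Fin 4)} (hl : 0 < l) (hy : ‖y‖ = l) (hu : ContDiffAt ℝ 2 u y) :
    fderiv ℝ (fun z => u z - kelvin (l ^ 2) u z - barrier a b l z) y y =
      2 * (u y + fderiv ℝ u y y) - a - 2 * b * l ^ 2 := by
  have hy0 : y ≠ 0 := norm_pos_iff.1 (hy ▸ hl)
  have h1 : l ^ 2 * (l ^ 2)⁻¹ = 1 := mul_inv_cancel₀ (by positivity)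
  have hzy : (l ^ 2 * (‖y‖ ^ 2)⁻¹) • y = y := by rw [hy, h1, one_smul]
  have hF := ((hu.sub (contDiffAt_kelvin (k := l ^ 2) hy0 (by rwa [hzy]))).sub
    (contDiffAt_barrier a b l hy0)).eventually_hasDerivAt_line y |>.self_of_nhds
  have h0 : y + (0 : ℝ) • y ≠ 0 := by simpa using hy0
  have hp := hasDerivAt_kelvin_factor_line (l ^ 2) y y 0 h0
  have hγ := hp.smul (hasDerivAt_line y y 0)
  have hu' : HasFDerivAt u (fderiv ℝ u y)
      ((l ^ 2 * (‖y + (0 : ℝ) • y‖ ^ 2)⁻¹) • (y + (0 : ℝ) • y)) := by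
    rw [zero_smul, add_zero, hzy]; exact (hu.differentiableAt (by norm_num)).hasFDerivAt
  have hK := hp.mul (hu'.comp_hasDerivAt (0 : ℝ) hγ)
  have hB := (((hasDerivAt_norm_inv_line y y 0 h0).const_mul l).const_sub 1 |>.const_mul a).add
    (((hasDerivAt_norm_sq_line y y 0).sub_const (l ^ 2)).const_mul b)
  have hU := (hu.eventually_hasDerivAt_line y).self_of_nhds
  have := hF.unique ((hU.sub hK).sub hB)
  simp only [zero_smul, add_zero, Function.comp, Pi.smul_apply', hy, h1, real_inner_self_eq_norm_sq, one_smul,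
    map_add, map_smul, smul_eq_mul] at this
  refine Eq.trans this ?_
  field_simp
  ring

lemma continuousAt_sub_kelvin_sub_barrier {u : EuclideanSpace ℝ (Fin 4) → ℝ} (a b : ℝ) {l : ℝ}
    {y : EuclideanSpace ℝ (Fin 4)} (hy : y ≠ 0) (hu : ContinuousAt u y)
    (hu' : ContinuousAt u ((l ^ 2 * (‖y‖ ^ 2)⁻¹) • y)) :
    ContinuousAt (fun p : ℝ × EuclideanSpace ℝ (Fin 4) =>
      u p.2 - kelvin (p.1 ^ 2) u p.2 - barrier a b p.1 p.2) (l, y) := by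
  have hn : ‖y‖ ≠ 0 := norm_ne_zero_iff.2 hy
  have h2 : ContinuousAt (fun p : ℝ × EuclideanSpace ℝ (Fin 4) => p.2) (l, y) :=
    continuousAt_snd
  have h1 : ContinuousAt (fun p : ℝ × EuclideanSpace ℝ (Fin 4) => p.1) (l, y) :=
    continuousAt_fst
  have hp : ContinuousAt (fun p : ℝ × EuclideanSpace ℝ (Fin 4) =>
      p.1 ^ 2 * (‖p.2‖ ^ 2)⁻¹) (l, y) :=
    (h1.pow 2).mul ((h2.norm.pow 2).inv₀ (pow_ne_zero 2 hn))
  have hk : ContinuousAt (fun p : ℝ × EuclideanSpace ℝ (Fin 4) => kelvin (p.1 ^ 2) u p.2) (l, y) :=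
    hp.mul (ContinuousAt.comp (x := (l, y)) (g := u) hu' (hp.smul h2))
  have hb : ContinuousAt (fun p : ℝ × EuclideanSpace ℝ (Fin 4) => barrier a b p.1 p.2) (l, y) :=
    ((continuousAt_const.sub (h1.mul (h2.norm.inv₀ hn))).const_mul a).add
      (((h2.norm.pow 2).sub (h1.pow 2)).const_mul b)
  exact ((ContinuousAt.comp (x := (l, y)) (g := u) hu h2).sub hk).sub hb

/-- Bounds on a function `u` on the ball of radius `ρ` that make the method of moving spheres
run up to radius `Λ`. -/
structure MovingSpheresData (u : EuclideanSpace ℝ (Fin 4) → ℝ) (ρ Λ N A m : ℝ) : Prop where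
  contDiffAt : ∀ z, ‖z‖ ≤ ρ → ContDiffAt ℝ 2 u z
  lap_bound : ∀ z, ‖z‖ ≤ ρ → |lap u z + 8 * u z ^ 3| ≤ A * u z
  lower : ∀ z, ‖z‖ ≤ ρ → m ≤ u z
  upper : ∀ z, ‖z‖ ≤ Λ → u z ≤ N
  A_pos : 0 < A
  m_pos : 0 < m
  rad_pos : 0 < Λ
  rad_lt : Λ < ρ
  A_mul_sq_le : A * ρ ^ 2 ≤ 4
  lt_lower : N * Λ ^ 2 * (ρ ^ 2)⁻¹ + 40 * A * N * Λ * ρ < m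

namespace MovingSpheresData

variable {u : EuclideanSpace ℝ (Fin 4) → ℝ} {ρ Λ N A m : ℝ}

lemma rho_pos (H : MovingSpheresData u ρ Λ N A m) : 0 < ρ := H.rad_pos.trans H.rad_lt

lemma N_pos (H : MovingSpheresData u ρ Λ N A m) : 0 < N :=
  H.m_pos.trans_le ((H.lower 0 (by simpa using H.rho_pos.le)).trans
    (H.upper 0 (by simpa using H.rad_pos.le)))

/-- The barrier whose Laplacian dominates the zeroth order terms. -/
noncomputable def phi (_ : MovingSpheresData u ρ Λ N A m) (l : ℝ) :
    EuclideanSpace ℝ (Fin 4) → ℝ :=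
  barrier (2 * A * N * Λ * ρ) (A * (2 * A * N * Λ * ρ)) l

lemma coeff_pos (H : MovingSpheresData u ρ Λ N A m) : 0 < 2 * A * N * Λ * ρ := by
  have := H.A_pos; have := H.N_pos; have := H.rad_pos; have := H.rho_pos
  positivity

lemma phi_le (H : MovingSpheresData u ρ Λ N A m) {l : ℝ} (hl : 0 < l)
    {y : EuclideanSpace ℝ (Fin 4)} (hy : ‖y‖ ≤ ρ) : H.phi l y ≤ 10 * A * N * Λ * ρ := by
  have h := barrier_le H.coeff_pos.le (mul_pos H.A_pos H.coeff_pos).le hl.le hy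
  have h2 := mul_le_mul_of_nonneg_left H.A_mul_sq_le H.coeff_pos.le
  unfold phi
  linarith

/-- The moving spheres comparison at radius `l`. -/
def Good (H : MovingSpheresData u ρ Λ N A m) (l : ℝ) : Prop :=
  ∀ y : EuclideanSpace ℝ (Fin 4), l ≤ ‖y‖ → ‖y‖ ≤ ρ → kelvin (l ^ 2) u y + H.phi l y ≤ u y

lemma kelvin_le (H : MovingSpheresData u ρ Λ N A m) {l : ℝ} (hl : 0 < l) (hlΛ : l ≤ Λ)
    {y : EuclideanSpace ℝ (Fin 4)} (hy : l ≤ ‖y‖) :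
    kelvin (l ^ 2) u y ≤ N * l ^ 2 * (‖y‖ ^ 2)⁻¹ := by
  have h : u ((l ^ 2 * (‖y‖ ^ 2)⁻¹) • y) ≤ N := H.upper _ ((norm_inversion_le hl hy).trans hlΛ)
  have := mul_le_mul_of_nonneg_left h (by positivity : 0 ≤ l ^ 2 * (‖y‖ ^ 2)⁻¹)
  unfold kelvin
  linarith

lemma lt_of_norm_eq (H : MovingSpheresData u ρ Λ N A m) {l : ℝ} (hl : 0 < l) (hlΛ : l ≤ Λ)
    {y : EuclideanSpace ℝ (Fin 4)} (hy : ‖y‖ = ρ) :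
    kelvin (l ^ 2) u y + H.phi l y < u y := by
  have hρ := H.rho_pos
  have h1 := H.kelvin_le hl hlΛ (hy ▸ (hlΛ.trans H.rad_lt.le) : l ≤ ‖y‖)
  have h2 := H.phi_le hl hy.le
  have h3 := H.lower y hy.le
  have h4 := H.lt_lower
  have h5 : N * l ^ 2 * (‖y‖ ^ 2)⁻¹ ≤ N * Λ ^ 2 * (ρ ^ 2)⁻¹ := by
    have := H.N_pos
    rw [hy]; gcongr
  have h6 := H.coeff_pos
  linarith

lemma lap_neg (H : MovingSpheresData u ρ Λ N A m) {l : ℝ} (hl : 0 < l) (hlΛ : l ≤ Λ)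
    {y : EuclideanSpace ℝ (Fin 4)} (hy : l ≤ ‖y‖) (hyρ : ‖y‖ ≤ ρ)
    (heq : u y = kelvin (l ^ 2) u y + H.phi l y) :
    lap (fun z => u z - kelvin (l ^ 2) u z - H.phi l z) y < 0 := by
  have hr : 0 < ‖y‖ := hl.trans_le hy
  have hy0 : y ≠ 0 := norm_pos_iff.1 hr
  have hzl := norm_inversion_le hl hy
  have hzρ := (hzl.trans hlΛ).trans H.rad_lt.le
  have hu := H.contDiffAt y hyρ
  have hu' := H.contDiffAt _ hzρ
  have hK := contDiffAt_kelvin (k := l ^ 2) hy0 hu'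
  have hA := H.A_pos
  have hN := H.N_pos
  have hΛ := H.rad_pos
  have hρ := H.rho_pos
  have hB : ContDiffAt ℝ 2 (H.phi l) y := contDiffAt_barrier _ _ l hy0
  rw [lap_sub (hu.sub hK) hB, lap_sub hu hK, lap_kelvin hy0 hu']
  rw [show lap (H.phi l) y = _ from lap_barrier _ _ l hy0]
  have hφ0 : 0 ≤ H.phi l y :=
    barrier_nonneg H.coeff_pos.le (mul_pos H.A_pos H.coeff_pos).le hl hy
  have hφ := H.phi_le hl hyρ
  have h1 := (abs_le.1 (H.lap_bound y hyρ)).2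
  have h2 := (abs_le.1 (H.lap_bound _ hzρ)).1
  have hwN := H.upper _ (hzl.trans hlΛ)
  have hw0 : 0 < u ((l ^ 2 * (‖y‖ ^ 2)⁻¹) • y) := H.m_pos.trans_le (H.lower _ hzρ)
  have hk : kelvin (l ^ 2) u y =
    l ^ 2 * (‖y‖ ^ 2)⁻¹ * u ((l ^ 2 * (‖y‖ ^ 2)⁻¹) • y) := rfl
  have hs1 := sq_mul_inv_sq_le_one hl hy
  have hs0 : 0 < l ^ 2 * (‖y‖ ^ 2)⁻¹ := by positivity
  have hsr : 2 * A * (l ^ 2 * (‖y‖ ^ 2)⁻¹ * N) ≤ 2 * A * N * Λ * ρ * l * ‖y‖⁻¹ ^ 3 := by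
    have e : 2 * A * (l ^ 2 * (‖y‖ ^ 2)⁻¹ * N) = 2 * A * N * l * ‖y‖ * l * ‖y‖⁻¹ ^ 3 := by
      field_simp
    rw [e]; gcongr
  have hAa : 0 < A * (2 * A * N * Λ * ρ) := mul_pos hA H.coeff_pos
  rw [hk] at heq
  generalize l ^ 2 * (‖y‖ ^ 2)⁻¹ = s at *
  generalize u (s • y) = w at *
  generalize lap u (s • y) = Lw at *
  generalize lap u y = Ly at *
  generalize H.phi l y = f at *
  generalize u y = U at *
  have hsw : 0 < s * w := mul_pos hs0 hw0
  have h3 : (s * w) ^ 3 ≤ U ^ 3 := by gcongr; linarith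
  have h4 : s ^ 3 * (-(A * w) - 8 * w ^ 3) ≤ s ^ 3 * Lw := by gcongr; linarith
  have h5 : s ^ 3 * (A * w) ≤ s * (A * w) := by
    have : s ^ 3 ≤ s := by nlinarith [mul_nonneg hs0.le (sub_nonneg.2 hs1), hs0]
    gcongr
  have h6 : A * (s * w) ≤ A * (s * N) := by gcongr
  have h7 : A * f ≤ A * (10 * A * N * Λ * ρ) := by gcongr
  have h8 : A * U = A * (s * w) + A * f := by rw [heq]; ring
  nlinarith

lemma not_touching (H : MovingSpheresData u ρ Λ N A m) {l : ℝ} (hl : 0 < l) (hlΛ : l ≤ Λ)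
    (hgood : H.Good l) {y : EuclideanSpace ℝ (Fin 4)} (hy : l ≤ ‖y‖) (hyρ : ‖y‖ ≤ ρ)
    (heq : u y = kelvin (l ^ 2) u y + H.phi l y)
    (hrad : fderiv ℝ (fun z => u z - kelvin (l ^ 2) u z - H.phi l z) y y ≤ 0) : False := by
  have hr : 0 < ‖y‖ := hl.trans_le hy
  have hy0 : y ≠ 0 := norm_pos_iff.1 hr
  have hzρ := ((norm_inversion_le hl hy).trans hlΛ).trans H.rad_lt.le
  have hylt : ‖y‖ < ρ := by
    refine lt_of_le_of_ne hyρ fun h => ?_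
    have := H.lt_of_norm_eq hl hlΛ h
    linarith
  refine absurd (H.lap_neg hl hlΛ hy hyρ heq) (not_lt.2 (lap_nonneg_of_touching
    (((H.contDiffAt y hyρ).sub (contDiffAt_kelvin hy0 (H.contDiffAt _ hzρ))).sub
      (contDiffAt_barrier _ _ l hy0)) hy0 (by linarith) hrad ?_))
  filter_upwards [continuous_norm.continuousAt.eventually_lt_const hylt] with z hz hz'
  have := hgood z (hy.trans hz') hz.le
  linarith

lemma lt_of_lt_norm (H : MovingSpheresData u ρ Λ N A m) {l : ℝ} (hl : 0 < l) (hlΛ : l ≤ Λ)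
    (hgood : H.Good l) {y : EuclideanSpace ℝ (Fin 4)} (hy : l < ‖y‖) (hyρ : ‖y‖ ≤ ρ) :
    kelvin (l ^ 2) u y + H.phi l y < u y := by
  refine lt_of_le_of_ne (hgood y hy.le hyρ) fun heq => ?_
  have hylt : ‖y‖ < ρ := by
    refine lt_of_le_of_ne hyρ fun h => ?_
    have := H.lt_of_norm_eq hl hlΛ h
    linarith
  have hmin : IsLocalMin (fun z => u z - kelvin (l ^ 2) u z - H.phi l z) y := by
    filter_upwards [continuous_norm.continuousAt.eventually_lt_const hylt,
      continuous_norm.continuousAt.eventually_const_lt hy] with z hz hz'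
    have := hgood z hz'.le hz.le
    linarith
  exact H.not_touching hl hlΛ hgood hy.le hyρ heq.symm (by rw [hmin.fderiv_eq_zero]; simp)

lemma radial_lt (H : MovingSpheresData u ρ Λ N A m) {l : ℝ} (hl : 0 < l) (hlΛ : l ≤ Λ)
    (hgood : H.Good l) {y : EuclideanSpace ℝ (Fin 4)} (hy : ‖y‖ = l) :
    2 * A * N * Λ * ρ + 2 * (A * (2 * A * N * Λ * ρ)) * l ^ 2 < 2 * (u y + fderiv ℝ u y y) := by
  have hyρ : ‖y‖ ≤ ρ := hy ▸ (hlΛ.trans H.rad_lt.le)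
  by_contra! hcon
  refine H.not_touching hl hlΛ hgood hy.ge hyρ (kelvin_add_barrier_of_norm_eq hl hy).symm ?_
  have := fderiv_sub_kelvin_sub_barrier_radial (a := 2 * A * N * Λ * ρ)
    (b := A * (2 * A * N * Λ * ρ)) hl hy (H.contDiffAt y hyρ)
  unfold phi
  rw [this]
  linarith

lemma continuousAt_radial (H : MovingSpheresData u ρ Λ N A m) {y : EuclideanSpace ℝ (Fin 4)}
    (hy : ‖y‖ ≤ ρ) : ContinuousAt (fun z => u z + fderiv ℝ u z z) y :=
  (H.contDiffAt y hy).continuousAt.add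
    ((H.contDiffAt y hy).hasFDerivAt_fderiv.continuousAt.clm_apply continuousAt_id)

lemma eventually_le (H : MovingSpheresData u ρ Λ N A m) {l : ℝ} (hl : 0 < l) (hlΛ : l ≤ Λ)
    (hgood : H.Good l) {y : EuclideanSpace ℝ (Fin 4)} (hy : l ≤ ‖y‖) (hyρ : ‖y‖ ≤ ρ) :
    ∀ᶠ p : ℝ × EuclideanSpace ℝ (Fin 4) in 𝓝 (l, y), p.1 ≤ ‖p.2‖ →
      kelvin (p.1 ^ 2) u p.2 + H.phi p.1 p.2 ≤ u p.2 := by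
  have hr : 0 < ‖y‖ := hl.trans_le hy
  have hy0 : y ≠ 0 := norm_pos_iff.1 hr
  rcases hy.lt_or_eq with hlt | hyl
  · have hzρ := ((norm_inversion_le hl hy).trans hlΛ).trans H.rad_lt.le
    have hc := continuousAt_sub_kelvin_sub_barrier (2 * A * N * Λ * ρ) (A * (2 * A * N * Λ * ρ))
      hy0 (H.contDiffAt y hyρ).continuousAt (H.contDiffAt _ hzρ).continuousAt
    have hpos := H.lt_of_lt_norm hl hlΛ hgood hlt hyρ
    have hpos' : 0 < u y - kelvin (l ^ 2) u y - H.phi l y := by linarith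
    filter_upwards [hc.eventually_const_lt hpos'] with p hp _
    change 0 < u p.2 - kelvin (p.1 ^ 2) u p.2 - H.phi p.1 p.2 at hp
    linarith
  · have hD := H.radial_lt hl hlΛ hgood hyl.symm
    obtain ⟨c, hc1, hc2⟩ := exists_between hD
    have h2 : ContinuousAt (fun p : ℝ × EuclideanSpace ℝ (Fin 4) => p.2) (l, y) :=
      continuousAt_snd
    have h1 : ContinuousAt (fun p : ℝ × EuclideanSpace ℝ (Fin 4) => p.1) (l, y) :=
      continuousAt_fst
    have hev : ∀ᶠ z in 𝓝 y, c / 2 < u z + fderiv ℝ u z z ∧ DifferentiableAt ℝ u z :=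
      ((H.continuousAt_radial hyρ).eventually_const_lt (by linarith)).and
        (((H.contDiffAt y hyρ).eventually (by norm_num)).mono
          fun z hz => hz.differentiableAt (by norm_num))
    obtain ⟨ε, hε, hball⟩ := Metric.eventually_nhds_iff.1 hev
    have hp : ContinuousAt (fun p : ℝ × EuclideanSpace ℝ (Fin 4) =>
        ‖p.2 - y‖ + (1 - p.1 ^ 2 * (‖p.2‖ ^ 2)⁻¹) * ‖p.2‖) (l, y) :=
      (h2.sub continuousAt_const).norm.add ((continuousAt_const.sub
        ((h1.pow 2).mul ((h2.norm.pow 2).inv₀ (pow_ne_zero 2 hr.ne')))).mul h2.norm)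
    have hp0 : ‖y - y‖ + (1 - l ^ 2 * (‖y‖ ^ 2)⁻¹) * ‖y‖ < ε := by
      rw [← hyl, mul_inv_cancel₀ (by positivity)]; simpa using hε
    have hq : ContinuousAt (fun p : ℝ × EuclideanSpace ℝ (Fin 4) =>
        c / 2 * (‖p.2‖ + p.1) - (2 * A * N * Λ * ρ * ‖p.2‖ +
          A * (2 * A * N * Λ * ρ) * ‖p.2‖ ^ 2 * (‖p.2‖ + p.1))) (l, y) :=
      ((h2.norm.add h1).const_mul _).sub ((h2.norm.const_mul _).add
        (((h2.norm.pow 2).const_mul _).mul (h2.norm.add h1)))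
    have hq0 : 0 < c / 2 * (‖y‖ + l) - (2 * A * N * Λ * ρ * ‖y‖ +
          A * (2 * A * N * Λ * ρ) * ‖y‖ ^ 2 * (‖y‖ + l)) := by
      rw [← hyl]
      have := mul_pos hl (sub_pos.2 hc1)
      linarith
    filter_upwards [hp.eventually_lt_const hp0, hq.eventually_const_lt hq0,
      h1.eventually_const_lt hl] with p hp1 hp2 hp3 hp4
    have hmem : ∀ t ∈ Set.Icc (p.1 ^ 2 * (‖p.2‖ ^ 2)⁻¹) 1, dist (t • p.2) y < ε := by
      intro t ht
      have e : t • p.2 - y = (p.2 - y) - (1 - t) • p.2 := by module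
      rw [dist_eq_norm, e]
      refine (norm_sub_le _ _).trans_lt (lt_of_le_of_lt ?_ hp1)
      rw [norm_smul, Real.norm_of_nonneg (by linarith [ht.2])]
      gcongr
      exact ht.1
    exact kelvin_add_barrier_le_of_ray hp3 hp4 (fun t ht => (hball (hmem t ht)).2)
      (fun t ht => (hball (hmem t ht)).1.le) (by linarith)

lemma exists_good (H : MovingSpheresData u ρ Λ N A m) : ∃ l, 0 < l ∧ l ≤ Λ ∧ H.Good l := by
  have hA := H.A_pos
  have hN := H.N_pos
  have hm := H.m_pos
  have ha := H.coeff_pos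
  have hNΛ : 0 ≤ N * Λ ^ 2 * (ρ ^ 2)⁻¹ := by positivity
  have ham : 20 * (2 * A * N * Λ * ρ) < m := by linarith [H.lt_lower]
  have h0 : ‖(0 : EuclideanSpace ℝ (Fin 4))‖ ≤ ρ := by simpa using H.rho_pos.le
  have hev : ∀ᶠ z in 𝓝 (0 : EuclideanSpace ℝ (Fin 4)),
      m / 2 < u z + fderiv ℝ u z z :=
    (H.continuousAt_radial h0).eventually_const_lt (by
      simp only [map_zero, add_zero]
      linarith [H.lower 0 h0])
  obtain ⟨δ, hδ, hball⟩ := Metric.eventually_nhds_iff.1 hev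
  have hlim : Tendsto (fun l : ℝ => N * l ^ 2 * (δ ^ 2)⁻¹) (𝓝[>] 0) (𝓝 0) := by
    have hc : Continuous fun l : ℝ => N * l ^ 2 * (δ ^ 2)⁻¹ := by fun_prop
    simpa using (hc.tendsto 0).mono_left nhdsWithin_le_nhds
  obtain ⟨l, hl1, hl2, hl3⟩ := ((hlim.eventually_lt_const (half_pos hm)).and
    (Ioc_mem_nhdsGT H.rad_pos)).exists
  refine ⟨l, hl2, hl3, fun y hy hyρ => ?_⟩
  have hr : 0 < ‖y‖ := lt_of_lt_of_le hl2 hy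
  rcases lt_or_ge ‖y‖ δ with hyδ | hyδ
  · have ht : ∀ t ∈ Set.Icc (l ^ 2 * (‖y‖ ^ 2)⁻¹) 1, ‖t • y‖ ≤ ‖y‖ := by
      intro t ht
      have : 0 ≤ t := le_trans (by positivity) ht.1
      rw [norm_smul, Real.norm_of_nonneg this]
      exact mul_le_of_le_one_left hr.le ht.2
    refine kelvin_add_barrier_le_of_ray hl2 hy
      (fun t h => (H.contDiffAt _ ((ht t h).trans hyρ)).differentiableAt (by norm_num))
      (fun t h => (hball (by rw [dist_zero_right]; exact (ht t h).trans_lt hyδ)).le) ?_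
    have h1 : A * (2 * A * N * Λ * ρ) * ‖y‖ ^ 2 ≤ 4 * (2 * A * N * Λ * ρ) := by
      have : A * ‖y‖ ^ 2 ≤ 4 := le_trans (by gcongr) H.A_mul_sq_le
      nlinarith
    have h2 : 0 < ‖y‖ + l := by linarith
    nlinarith [mul_le_mul_of_nonneg_right h1 h2.le, mul_lt_mul_of_pos_right ham h2,
      mul_pos ha hr, mul_pos ha hl2]
  · have h1 := H.kelvin_le hl2 hl3 hy
    have h2 : N * l ^ 2 * (‖y‖ ^ 2)⁻¹ ≤ N * l ^ 2 * (δ ^ 2)⁻¹ := by gcongr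
    have h3 := H.phi_le hl2 hyρ
    have h4 := H.lower y hyρ
    linarith

lemma good (H : MovingSpheresData u ρ Λ N A m) : H.Good Λ := by
  obtain ⟨l₀, hl₀, hl₀Λ, hgood₀⟩ := H.exists_good
  have hclosed : IsClosed ({l | H.Good l} ∩ Set.Icc l₀ Λ) := by
    refine IsSeqClosed.isClosed fun x l hx hxl => ?_
    have hl : l ∈ Set.Icc l₀ Λ := isClosed_Icc.mem_of_tendsto hxl
      (Eventually.of_forall fun n => (hx n).2)
    refine ⟨fun y hy hyρ => ?_, hl⟩
    have hlpos : 0 < l := hl₀.trans_le hl.1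
    rcases hy.lt_or_eq with hlt | hyl
    · have hy0 : y ≠ 0 := norm_pos_iff.1 (hlpos.trans hlt)
      have hzρ := ((norm_inversion_le hlpos hy).trans hl.2).trans H.rad_lt.le
      have hc := continuousAt_sub_kelvin_sub_barrier (2 * A * N * Λ * ρ)
        (A * (2 * A * N * Λ * ρ)) hy0 (H.contDiffAt y hyρ).continuousAt
        (H.contDiffAt _ hzρ).continuousAt
      have hlim := hc.tendsto.comp (hxl.prodMk_nhds (tendsto_const_nhds (x := y)))
      have h := ge_of_tendsto hlim (b := 0) (by
        filter_upwards [hxl.eventually_lt_const hlt] with n hn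
        have := (hx n).1 y hn.le hyρ
        change 0 ≤ u y - kelvin (x n ^ 2) u y - H.phi (x n) y
        linarith)
      change 0 ≤ u y - kelvin (l ^ 2) u y - H.phi l y at h
      linarith
    · exact (kelvin_add_barrier_of_norm_eq hlpos hyl.symm).le
  have hsub := hclosed.Icc_subset_of_forall_mem_nhdsWithin hgood₀ (fun l hl => by
    have hlpos : 0 < l := hl₀.trans_le hl.2.1
    have hK : IsCompact (closedBall (0 : EuclideanSpace ℝ (Fin 4)) ρ ∩ {y | l ≤ ‖y‖}) :=
      (isCompact_closedBall _ _).inter_right (isClosed_le continuous_const continuous_norm)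
    have hev := hK.eventually_forall_of_forall_eventually (x₀ := l)
      (P := fun l y => l ≤ ‖y‖ → kelvin (l ^ 2) u y + H.phi l y ≤ u y)
      (fun y hy => H.eventually_le hlpos hl.2.2.le hl.1 hy.2 (by simpa using hy.1))
    filter_upwards [hev.filter_mono nhdsWithin_le_nhds, self_mem_nhdsWithin] with l' h1 h2
    have h2' : l < l' := h2
    exact fun y hy hyρ => h1 y ⟨by simpa using hyρ, h2'.le.trans hy⟩ hy)
  exact hsub ⟨hl₀Λ, le_rfl⟩

lemma kelvin_le_self (H : MovingSpheresData u ρ Λ N A m) {y : EuclideanSpace ℝ (Fin 4)}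
    (hy : Λ ≤ ‖y‖) (hyρ : ‖y‖ ≤ ρ) : kelvin (Λ ^ 2) u y ≤ u y := by
  have h1 := H.good y hy hyρ
  have h2 : 0 ≤ H.phi Λ y :=
    barrier_nonneg H.coeff_pos.le (mul_pos H.A_pos H.coeff_pos).le H.rad_pos hy
  linarith

end MovingSpheresData

lemma lap_nonneg_of_isLocalMin {F : EuclideanSpace ℝ (Fin 4) → ℝ}
    {y : EuclideanSpace ℝ (Fin 4)} (hF : ContDiffAt ℝ 2 F y) (hmin : IsLocalMin F y) :
    0 ≤ lap F y := by
  rw [lap_eq_sum hF]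
  refine Finset.sum_nonneg fun i _ => ?_
  refine nonneg_second_deriv_of_eventually
    (g := fun t => F (y + t • EuclideanSpace.single i (1 : ℝ)) - F y)
    ((hF.eventually_hasDerivAt_line (EuclideanSpace.single i 1)).mono
      fun t ht => ht.sub_const _) (hF.hasDerivAt_fderiv_line _) (by simp)
    (by simp [hmin.fderiv_eq_zero]) ?_
  refine ((eventually_line (EuclideanSpace.single i (1 : ℝ)) hmin).mono fun t ht => ?_).filter_mono
    nhdsWithin_le_nhds
  exact sub_nonneg.2 ht

section Harnack

variable {Ω : Set (EuclideanSpace ℝ (Fin 4))} {u : EuclideanSpace ℝ (Fin 4) → ℝ}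
  {p : EuclideanSpace ℝ (Fin 4)} {A m τ : ℝ}

/-- Moving spheres show that `u` is nearly constant near `p` at the scale `τ ^ 3 = (u p)⁻¹`. -/
lemma three_quarters_le_of_dist_le (hΩ : IsOpen Ω) (hu : ContDiffOn ℝ 2 u Ω)
    (hlap : ∀ z ∈ Ω, |lap u z + 8 * u z ^ 3| ≤ A * u z) (hm : ∀ z ∈ Ω, m ≤ u z)
    (hA : 0 < A) (hτ : 0 < τ) (hτ' : τ ≤ 1 / 10) (hAτ : A * τ ≤ 1)
    (hball : closedBall p (2 * τ) ⊆ Ω)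
    (hsup : ∀ z ∈ closedBall p (7 * τ ^ 3), u z ≤ 2 * u p) (hup : u p * τ ^ 3 = 1)
    (hmτ : (100 + 400 * A) * τ < m) {q : EuclideanSpace ℝ (Fin 4)} (hq : ‖q - p‖ ≤ τ ^ 3) :
    3 / 4 * u p ≤ u q := by
  have hμ : 0 < u p := pos_of_mul_pos_left (hup ▸ one_pos) (by positivity)
  rcases eq_or_ne q p with rfl | hne
  · linarith
  have hδ : 0 < ‖q - p‖ := norm_pos_iff.2 (sub_ne_zero.2 hne)
  set δ := ‖q - p‖ with hδdef
  have hΛsq : (√12 * δ) ^ 2 = 12 * δ ^ 2 := by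
    rw [mul_pow, Real.sq_sqrt (by norm_num)]
  have h12 : √12 ≤ 4 := Real.sqrt_le_iff.2 (by norm_num)
  have hΛ : √12 * δ ≤ 4 * τ ^ 3 := by gcongr
  have hτ3 : τ ^ 3 ≤ τ / 100 := by nlinarith [mul_pos hτ hτ]
  have hxp : ∀ z : EuclideanSpace ℝ (Fin 4), dist (p + (3 : ℝ) • (p - q) + z) p ≤ 3 * δ + ‖z‖ := by
    intro z
    have e : p + (3 : ℝ) • (p - q) + z - p = (3 : ℝ) • (p - q) + z := by abel
    rw [dist_eq_norm, e, hδdef, norm_sub_rev q p]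
    refine (norm_add_le _ _).trans ?_
    rw [norm_smul]; norm_num
  have hmem : ∀ z : EuclideanSpace ℝ (Fin 4), ‖z‖ ≤ τ → p + (3 : ℝ) • (p - q) + z ∈ Ω :=
    fun z hz => hball ((hxp z).trans (by linarith))
  have H : MovingSpheresData (fun z => u (p + (3 : ℝ) • (p - q) + z)) τ (√12 * δ) (2 * u p) A m :=
    { contDiffAt := fun z hz => (hu.contDiffAt (hΩ.mem_nhds (hmem z hz))).comp z
        (contDiffAt_const.add contDiffAt_id)
      lap_bound := fun z hz => by rw [lap_comp_add_left]; exact hlap _ (hmem z hz)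
      lower := fun z hz => hm _ (hmem z hz)
      upper := fun z hz => hsup _ ((hxp z).trans (by linarith))
      A_pos := hA
      m_pos := lt_trans (by positivity) hmτ
      rad_pos := by positivity
      rad_lt := by linarith
      A_mul_sq_le := by nlinarith
      lt_lower := by
        have h1 : 2 * u p * (√12 * δ) ^ 2 * (τ ^ 2)⁻¹ ≤ 24 * τ := by
          rw [hΛsq, ← div_eq_mul_inv, div_le_iff₀ (by positivity)]
          have : δ ^ 2 ≤ (τ ^ 3) ^ 2 := by gcongr
          have h2 : u p * δ ^ 2 ≤ u p * (τ ^ 3) ^ 2 := by gcongr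
          have h3 : u p * (τ ^ 3) ^ 2 = τ ^ 3 := by rw [sq, ← mul_assoc, hup, one_mul]
          linarith
        have h2 : 40 * A * (2 * u p) * (√12 * δ) * τ ≤ 320 * A * τ := by
          have : 40 * A * (2 * u p) * (√12 * δ) * τ ≤ 40 * A * (2 * u p) * (4 * τ ^ 3) * τ := by
            gcongr
          refine this.trans_eq ?_
          linear_combination 320 * A * τ * hup
        nlinarith [mul_pos hA hτ] }
  have hy : ‖(4 : ℝ) • (q - p)‖ = 4 * δ := by rw [norm_smul]; norm_num; rfl
  have hk := H.kelvin_le_self (y := (4 : ℝ) • (q - p)) (by rw [hy]; gcongr) (by rw [hy]; linarith)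
  have hfac : (√12 * δ) ^ 2 * (‖(4 : ℝ) • (q - p)‖ ^ 2)⁻¹ = 3 / 4 := by
    rw [hΛsq, hy]; field_simp; norm_num
  unfold kelvin at hk
  rw [hfac] at hk
  beta_reduce at hk
  have e1 : p + (3 : ℝ) • (p - q) + (3 / 4 : ℝ) • (4 : ℝ) • (q - p) = p := by module
  have e2 : p + (3 : ℝ) • (p - q) + (4 : ℝ) • (q - p) = q := by module
  rwa [e1, e2] at hk

lemma lower_bound_le_of_concentration (hΩ : IsOpen Ω) (hu : ContDiffOn ℝ 2 u Ω)
    (hlap : ∀ z ∈ Ω, |lap u z + 8 * u z ^ 3| ≤ A * u z) (hm : ∀ z ∈ Ω, m ≤ u z)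
    (hA : 0 < A) (hτ : 0 < τ) (hτ' : τ ≤ 1 / 10) (hAτ : A * τ ≤ 1)
    (hball : closedBall p (2 * τ) ⊆ Ω)
    (hsup : ∀ z ∈ closedBall p (7 * τ ^ 3), u z ≤ 2 * u p) (hup : u p * τ ^ 3 = 1) :
    m ≤ (100 + 400 * A) * τ := by
  by_contra! hmτ
  have hμ : 0 < u p := pos_of_mul_pos_left (hup ▸ one_pos) (by positivity)
  have hτ3 : τ ^ 3 ≤ τ / 100 := by nlinarith [mul_pos hτ hτ]
  have hlow : ∀ z : EuclideanSpace ℝ (Fin 4), ‖z‖ ≤ τ ^ 3 → 3 / 4 * u p ≤ u (p + z) :=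
    fun z hz => three_quarters_le_of_dist_le hΩ hu hlap hm hA hτ hτ' hAτ hball hsup hup hmτ
      (by simpa using hz)
  have hmem : ∀ z : EuclideanSpace ℝ (Fin 4), ‖z‖ ≤ τ ^ 3 → p + z ∈ Ω := fun z hz =>
    hball (by rw [mem_closedBall, dist_self_add_left]; linarith)
  have hcd : ∀ z : EuclideanSpace ℝ (Fin 4), ‖z‖ ≤ τ ^ 3 →
      ContDiffAt ℝ 2 (fun z => u (p + z)) z := fun z hz =>
    (hu.contDiffAt (hΩ.mem_nhds (hmem z hz))).comp z (contDiffAt_const.add contDiffAt_id)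
  have hsq : ∀ z : EuclideanSpace ℝ (Fin 4),
      ContDiffAt ℝ 2 (fun z : EuclideanSpace ℝ (Fin 4) => ‖z‖ ^ 2) z := fun z =>
    (contDiff_norm_sq ℝ).contDiffAt
  have hf : ∀ z : EuclideanSpace ℝ (Fin 4), ‖z‖ ≤ τ ^ 3 →
      ContDiffAt ℝ 2 (fun z => u (p + z) + 2 / 5 * u p ^ 3 * ‖z‖ ^ 2) z := fun z hz =>
    (hcd z hz).add (contDiffAt_const.mul (hsq z))
  obtain ⟨z, hz, hzmin⟩ := (isCompact_closedBall (0 : EuclideanSpace ℝ (Fin 4))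
    (τ ^ 3)).exists_isMinOn ⟨0, by simpa using (by positivity : 0 ≤ τ ^ 3)⟩
    (fun z hz => (hf z (by simpa using hz)).continuousAt.continuousWithinAt)
  rw [mem_closedBall_zero_iff] at hz
  have hz0 : u (p + z) + 2 / 5 * u p ^ 3 * ‖z‖ ^ 2 ≤ u p := by
    simpa using hzmin (by simpa using (by positivity : 0 ≤ τ ^ 3) :
      (0 : EuclideanSpace ℝ (Fin 4)) ∈ closedBall 0 (τ ^ 3))
  have hlowz := hlow z hz
  have hzlt : ‖z‖ < τ ^ 3 := by
    refine lt_of_le_of_ne hz fun h => ?_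
    have e : u p ^ 3 * ‖z‖ ^ 2 = u p := by
      rw [h]; linear_combination (u p ^ 2 * τ ^ 3 + u p) * hup
    linarith
  have hloc : IsLocalMin (fun z => u (p + z) + 2 / 5 * u p ^ 3 * ‖z‖ ^ 2) z :=
    hzmin.isLocalMin (closedBall_mem_nhds_of_mem (by simpa using hzlt))
  have hnonneg := lap_nonneg_of_isLocalMin (hf z hz) hloc
  rw [lap_add (hcd z hz) (contDiffAt_const.mul (hsq z)), lap_const_mul _ (hsq z), lap_norm_sq,
    lap_comp_add_left] at hnonneg
  have h1 := (abs_le.1 (hlap _ (hmem z hz))).2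
  have hAμ : A ≤ u p ^ 2 / 10 := by
    have h2 : A * τ * (u p ^ 2 * τ ^ 5) ≤ 1 * (u p ^ 2 * τ ^ 5) := by gcongr
    have h3 : A * τ * (u p ^ 2 * τ ^ 5) = A := by
      linear_combination A * (u p * τ ^ 3 + 1) * hup
    have h4 : τ ^ 5 ≤ (1 / 10) ^ 5 := by gcongr
    have h5 : u p ^ 2 * τ ^ 5 ≤ u p ^ 2 * (1 / 10) ^ 5 := by gcongr
    nlinarith [sq_nonneg (u p)]
  have hU : (3 / 4 * u p) * (8 * (3 / 4 * u p) ^ 2 - u p ^ 2 / 10) ≤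
      u (p + z) * (8 * u (p + z) ^ 2 - A) := by
    have : 0 ≤ 8 * (3 / 4 * u p) ^ 2 - u p ^ 2 / 10 := by nlinarith [sq_nonneg (u p)]
    have hUz : 0 ≤ u (p + z) := le_trans (by positivity) hlowz
    gcongr
  nlinarith [pow_pos hμ 3]

/-- Among the points of a ball, the maximum of `u` weighted by the distance to the boundary
is attained at a point near which `u` at most doubles. -/
lemma exists_doubling_point {x₀ : EuclideanSpace ℝ (Fin 4)} {r : ℝ} (hr : 0 < r)
    (hu : ContinuousOn u (closedBall x₀ r)) (hpos : ∀ z ∈ closedBall x₀ r, 0 < u z) :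
    ∃ p ∈ closedBall x₀ r, u x₀ ≤ u p ∧
      ∀ z, dist z p * (2 * u p) ≤ r * u x₀ → u z ≤ 2 * u p := by
  have h0 : x₀ ∈ closedBall x₀ r := mem_closedBall_self hr.le
  obtain ⟨p, hp, hmax⟩ := (isCompact_closedBall x₀ r).exists_isMaxOn ⟨x₀, h0⟩
    (f := fun z => (r - dist z x₀) * u z) (by fun_prop)
  have hup := hpos p hp
  have hmax0 : r * u x₀ ≤ (r - dist p x₀) * u p := by simpa using hmax h0
  have hd0 : 0 ≤ dist p x₀ := dist_nonneg
  refine ⟨p, hp, ?_, fun z hz => ?_⟩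
  · nlinarith [mul_nonneg hd0 hup.le]
  · have hrx : 0 < r * u x₀ := mul_pos hr (hpos _ h0)
    have hd : 0 < r - dist p x₀ := pos_of_mul_pos_left (hrx.trans_le hmax0) hup.le
    have hzp : dist z p ≤ (r - dist p x₀) / 2 := by
      have : dist z p * (2 * u p) ≤ (r - dist p x₀) / 2 * (2 * u p) := by linarith
      exact le_of_mul_le_mul_right this (by positivity)
    have htri := dist_triangle z p x₀
    have hzmem : z ∈ closedBall x₀ r := by rw [mem_closedBall]; linarith
    have h1 : (r - dist z x₀) * u z ≤ (r - dist p x₀) * u p := hmax hzmem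
    have h2 : (r - dist p x₀) / 2 * u z ≤ (r - dist z x₀) * u z :=
      mul_le_mul_of_nonneg_right (by linarith) (hpos z hzmem).le
    have h3 : (r - dist p x₀) * u z ≤ (r - dist p x₀) * (2 * u p) := by linarith
    exact le_of_mul_le_mul_left h3 hd

end Harnack

/-- Theorem 1.1 of the paper (flat case): sup × inf estimate in dimension 4 for the
Yamabe-type equation `−Δu + h·u = 8u³`. -/
theorem sup_inf_estimate (Ω : Set (EuclideanSpace ℝ (Fin 4))) (hΩ : IsOpen Ω)
    (K : Set (EuclideanSpace ℝ (Fin 4))) (hK : IsCompact K) (hKΩ : K ⊆ Ω)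
    (A : ℝ) (hA : 0 < A) :
    ∃ c > 0, ∀ h u : EuclideanSpace ℝ (Fin 4) → ℝ,
      Measurable h → (∀ x ∈ Ω, |h x| ≤ A) →
      ContDiffOn ℝ 2 u Ω → (∀ x ∈ Ω, 0 < u x) →
      (∀ x ∈ Ω, -lap u x + h x * u x = 8 * (u x) ^ 3) →
      (sSup (u '' K)) ^ ((1 : ℝ) / 3) * sInf (u '' Ω) ≤ c := by
  obtain ⟨R, hR, hRΩ⟩ := hK.exists_cthickening_subset_open hΩ hKΩ
  obtain ⟨σ, hσ, hσ1, hσ2, hσ3⟩ : ∃ σ : ℝ, 0 < σ ∧ σ ≤ 1 / 10 ∧ 4 * σ ≤ R ∧ A * σ ≤ 1 := by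
    refine ⟨min (1 / 10) (min (R / 4) A⁻¹), by positivity, min_le_left _ _, ?_, ?_⟩
    · have : min (1 / 10) (min (R / 4) A⁻¹) ≤ R / 4 := (min_le_right _ _).trans (min_le_left _ _)
      linarith
    · have : min (1 / 10) (min (R / 4) A⁻¹) ≤ A⁻¹ := (min_le_right _ _).trans (min_le_right _ _)
      calc A * _ ≤ A * A⁻¹ := by gcongr
        _ = 1 := mul_inv_cancel₀ hA.ne'
  refine ⟨100 + 400 * A + σ⁻¹ ^ 4, by positivity, fun h u _ hh hu hpos heq => ?_⟩
  rcases K.eq_empty_or_nonempty with rfl | hKne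
  · rw [Set.image_empty, Real.sSup_empty, Real.zero_rpow (by norm_num), zero_mul]
    positivity
  obtain ⟨x₀, hx₀, hmax⟩ := hK.exists_isMaxOn hKne (hu.continuousOn.mono hKΩ)
  have hsup : sSup (u '' K) = u x₀ :=
    IsGreatest.csSup_eq ⟨Set.mem_image_of_mem u hx₀, by rintro _ ⟨z, hz, rfl⟩; exact hmax hz⟩
  rw [hsup]
  have hm : ∀ z ∈ Ω, sInf (u '' Ω) ≤ u z := fun z hz =>
    csInf_le ⟨0, by rintro _ ⟨w, hw, rfl⟩; exact (hpos w hw).le⟩ (Set.mem_image_of_mem u hz)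
  have hx₀Ω := hKΩ hx₀
  have hM := hpos x₀ hx₀Ω
  have hcube : ∀ x : ℝ, 0 < x → (x ^ ((1 : ℝ) / 3)) ^ 3 = x := fun x hx => by
    rw [← Real.rpow_natCast, ← Real.rpow_mul hx.le]; norm_num
  have ha : 0 < u x₀ ^ ((1 : ℝ) / 3) := Real.rpow_pos_of_pos hM _
  rcases le_or_gt (u x₀ ^ ((1 : ℝ) / 3)) σ⁻¹ with hsmall | hlarge
  · calc u x₀ ^ ((1 : ℝ) / 3) * sInf (u '' Ω)
        ≤ u x₀ ^ ((1 : ℝ) / 3) * (u x₀ ^ ((1 : ℝ) / 3)) ^ 3 := by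
          rw [hcube _ hM]; gcongr; exact hm _ hx₀Ω
      _ = (u x₀ ^ ((1 : ℝ) / 3)) ^ 4 := by ring
      _ ≤ σ⁻¹ ^ 4 := by gcongr
      _ ≤ 100 + 400 * A + σ⁻¹ ^ 4 := by linarith
  have hballΩ : closedBall x₀ R ⊆ Ω := (closedBall_subset_cthickening hx₀ R).trans hRΩ
  have hhalf : closedBall x₀ (R / 2) ⊆ Ω :=
    (closedBall_subset_closedBall (by linarith)).trans hballΩ
  obtain ⟨p, hp, hxp, hdouble⟩ := exists_doubling_point (half_pos hR)
    (hu.continuousOn.mono hhalf) (fun z hz => hpos z (hhalf hz))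
  have hμ := hM.trans_le hxp
  have hab : u x₀ ^ ((1 : ℝ) / 3) ≤ u p ^ ((1 : ℝ) / 3) :=
    Real.rpow_le_rpow hM.le hxp (by norm_num)
  have hb := ha.trans_le hab
  have hτσ : (u p ^ ((1 : ℝ) / 3))⁻¹ ≤ σ := inv_le_of_inv_le₀ hσ (hlarge.le.trans hab)
  have hup : u p * (u p ^ ((1 : ℝ) / 3))⁻¹ ^ 3 = 1 := by
    rw [inv_pow, hcube _ hμ, mul_inv_cancel₀ hμ.ne']
  have hRM : 14 ≤ R / 2 * u x₀ := by
    have h1 : σ⁻¹ ^ 3 ≤ u x₀ := by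
      rw [← hcube _ hM]; gcongr
    have h2 : 10 ≤ σ⁻¹ := by rw [le_inv_comm₀ (by norm_num) hσ]; linarith
    have h3 : 2 * σ * σ⁻¹ ^ 3 ≤ R / 2 * u x₀ := by gcongr; linarith
    have h4 : 2 * σ * σ⁻¹ ^ 3 = 2 * σ⁻¹ ^ 2 := by field_simp
    nlinarith
  have hmain := lower_bound_le_of_concentration (p := p) (m := sInf (u '' Ω)) hΩ hu
    (fun z hz => by
      have e : lap u z + 8 * u z ^ 3 = h z * u z := by linarith [heq z hz]
      rw [e, abs_mul, abs_of_pos (hpos z hz)]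
      exact mul_le_mul_of_nonneg_right (hh z hz) (hpos z hz).le)
    hm hA (inv_pos.2 hb) (hτσ.trans hσ1) (le_trans (by gcongr) hσ3)
    ((closedBall_subset_closedBall' (by rw [mem_closedBall] at hp; linarith)).trans hballΩ)
    (fun z hz => hdouble z (by
      have h1 : dist z p * (2 * u p) ≤ 7 * (u p ^ ((1 : ℝ) / 3))⁻¹ ^ 3 * (2 * u p) := by
        gcongr; exact hz
      linarith)) hup
  have hmul : u x₀ ^ ((1 : ℝ) / 3) * (u p ^ ((1 : ℝ) / 3))⁻¹ ≤ 1 := by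
    rw [← div_eq_mul_inv]; exact (div_le_one hb).2 hab
  have h1 := mul_le_mul_of_nonneg_left hmain ha.le
  have h2 := mul_le_mul_of_nonneg_left hmul (by positivity : 0 ≤ 100 + 400 * A)
  have h3 : 0 < σ⁻¹ ^ 4 := by positivity
  linarith
end

section
/- Let Ω ⊆ ℝ⁴ be an open set, K ⊆ Ω a compact set, A > 0 and m > 0. There exists a constant c > 0, depending only on A, m, K and Ω, such that for every measurable function h : Ω → ℝ with |h(x)| ≤ A for all x ∈ Ω and every positive C² function u : Ω → ℝ satisfying −Δu + h·u = 8u³ on Ω and inf_{x ∈ Ω} u(x) ≥ m, one has sup_{x ∈ K} u(x) ≤ c. -/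
open Filter Topology Metric

/-- `f` is differentiable near `0`, with first derivative `b` and second derivative `a` at `0`. -/
def HasTwoDerivs {V : Type*} [NormedAddCommGroup V] [NormedSpace ℝ V]
    (f : ℝ → V) (b a : V) : Prop :=
  ∃ f' : ℝ → V, (∀ᶠ t in 𝓝 0, HasDerivAt f (f' t) t) ∧ f' 0 = b ∧ HasDerivAt f' a 0

namespace HasTwoDerivs

variable {V : Type*} [NormedAddCommGroup V] [NormedSpace ℝ V]

theorem const (c : V) : HasTwoDerivs (fun _ => c) 0 0 :=
  ⟨fun _ => 0, .of_forall fun t => hasDerivAt_const t c, rfl, hasDerivAt_const 0 0⟩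

theorem line (y e : V) : HasTwoDerivs (fun t : ℝ => y + t • e) e 0 := by
  refine ⟨fun _ => e, .of_forall fun t => ?_, rfl, hasDerivAt_const 0 e⟩
  simpa using ((hasDerivAt_id t).smul_const e).const_add y

theorem add {f g : ℝ → V} {b a b' a' : V} (hf : HasTwoDerivs f b a) (hg : HasTwoDerivs g b' a') :
    HasTwoDerivs (fun t => f t + g t) (b + b') (a + a') := by
  obtain ⟨f', hf, rfl, hf'⟩ := hf
  obtain ⟨g', hg, rfl, hg'⟩ := hg
  exact ⟨fun t => f' t + g' t, by filter_upwards [hf, hg] with t h1 h2 using h1.add h2, rfl,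
    hf'.add hg'⟩

theorem sub {f g : ℝ → V} {b a b' a' : V} (hf : HasTwoDerivs f b a) (hg : HasTwoDerivs g b' a') :
    HasTwoDerivs (fun t => f t - g t) (b - b') (a - a') := by
  obtain ⟨f', hf, rfl, hf'⟩ := hf
  obtain ⟨g', hg, rfl, hg'⟩ := hg
  exact ⟨fun t => f' t - g' t, by filter_upwards [hf, hg] with t h1 h2 using h1.sub h2, rfl,
    hf'.sub hg'⟩

theorem smul {k : ℝ → ℝ} {f : ℝ → V} {b a : V} {k₁ k₂ : ℝ} (hk : HasTwoDerivs k k₁ k₂)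
    (hf : HasTwoDerivs f b a) :
    HasTwoDerivs (fun t => k t • f t) (k 0 • b + k₁ • f 0)
      (k 0 • a + (2 * k₁) • b + k₂ • f 0) := by
  obtain ⟨k', hk, rfl, hk'⟩ := hk
  obtain ⟨f', hf, rfl, hf'⟩ := hf
  refine ⟨fun t => k t • f' t + k' t • f t,
    by filter_upwards [hk, hf] with t h1 h2 using h1.smul h2, rfl, ?_⟩
  refine ((hk.self_of_nhds.smul hf').add (hk'.smul hf.self_of_nhds)).congr_deriv ?_
  module

theorem const_smul {f : ℝ → V} {b a : V} (c : ℝ) (hf : HasTwoDerivs f b a) :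
    HasTwoDerivs (fun t => c • f t) (c • b) (c • a) := by
  simpa using (const c).smul hf

theorem comp {W : Type*} [NormedAddCommGroup W] [NormedSpace ℝ W] {u : V → W} {c : ℝ → V} {b a : V}
    (hu : ContDiffAt ℝ 2 u (c 0)) (hc : HasTwoDerivs c b a) :
    HasTwoDerivs (fun t => u (c t)) (fderiv ℝ u (c 0) b)
      (fderiv ℝ (fderiv ℝ u) (c 0) b b + fderiv ℝ u (c 0) a) := by
  obtain ⟨c', hc, rfl, hc'⟩ := hc
  have hcont : ContinuousAt c 0 := hc.self_of_nhds.continuousAt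
  have hd : ∀ᶠ z in 𝓝 (c 0), DifferentiableAt ℝ u z :=
    (hu.eventually (by simp)).mono fun z hz => hz.differentiableAt (by simp)
  have hdd : DifferentiableAt ℝ (fderiv ℝ u) (c 0) :=
    (hu.fderiv_right (m := 1) (by norm_num)).differentiableAt (by simp)
  refine ⟨fun t => fderiv ℝ u (c t) (c' t), ?_, rfl, ?_⟩
  · filter_upwards [hc, hcont.eventually hd] with t h1 h2
    exact h2.hasFDerivAt.comp_hasDerivAt t h1
  · exact (hdd.hasFDerivAt.comp_hasDerivAt (0 : ℝ) hc.self_of_nhds).clm_apply hc'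

theorem comp_real {φ φ' : ℝ → ℝ} {φ₂ : ℝ} {c : ℝ → ℝ} {b a : ℝ}
    (h1 : ∀ᶠ s in 𝓝 (c 0), HasDerivAt φ (φ' s) s) (h2 : HasDerivAt φ' φ₂ (c 0))
    (hc : HasTwoDerivs c b a) :
    HasTwoDerivs (fun t => φ (c t)) (φ' (c 0) * b) (φ₂ * b ^ 2 + φ' (c 0) * a) := by
  obtain ⟨c', hc, rfl, hc'⟩ := hc
  have hcont : ContinuousAt c 0 := hc.self_of_nhds.continuousAt
  refine ⟨fun t => φ' (c t) * c' t, ?_, rfl, ?_⟩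
  · filter_upwards [hc, hcont.eventually h1] with t h3 h4
    exact h4.comp t h3
  · refine ((h2.comp (0 : ℝ) hc.self_of_nhds).mul hc').congr_deriv ?_
    simp; ring

theorem nonneg_of_isLocalMin {f : ℝ → ℝ} {b a : ℝ} (hf : HasTwoDerivs f b a)
    (hmin : IsLocalMin f 0) : 0 ≤ a := by
  obtain ⟨f', hf, rfl, hf'⟩ := hf
  have h0 : f' 0 = 0 := hmin.hasDerivAt_eq_zero hf.self_of_nhds
  have hd : deriv f =ᶠ[𝓝 0] f' := hf.mono fun t ht => ht.deriv
  have hdd : deriv (deriv f) 0 = a := (hf'.congr_of_eventuallyEq hd).deriv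
  by_contra! ha
  have hmax : IsLocalMax f 0 := isLocalMax_of_deriv_deriv_neg (by rw [hdd]; exact ha)
    (by rw [hf.self_of_nhds.deriv, h0]) hf.self_of_nhds.continuousAt
  have hc : f =ᶠ[𝓝 0] fun _ => f 0 := by
    filter_upwards [hmin, hmax] with t h1 h2 using le_antisymm h2 h1
  have : deriv (deriv f) 0 = 0 := by
    rw [hc.deriv.deriv_eq]; simp
  linarith

end HasTwoDerivs

local notation "E4" => EuclideanSpace ℝ (Fin 4)
local notation "e4" => fun i : Fin 4 => (EuclideanSpace.single i (1 : ℝ) : E4)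

theorem lap_eq_sum_s1 {u : E4 → ℝ} {x : E4} (hu : ContDiffAt ℝ 2 u x) :
    lap u x = ∑ i, fderiv ℝ (fderiv ℝ u) x (e4 i) (e4 i) := by
  have hdd : DifferentiableAt ℝ (fderiv ℝ u) x :=
    (hu.fderiv_right (m := 1) (by norm_num)).differentiableAt (by simp)
  refine Finset.sum_congr rfl fun i _ => ?_
  rw [fderiv_clm_apply hdd (differentiableAt_const _)]
  simp

theorem hasTwoDerivs_norm_sq (y : E4) (i : Fin 4) :
    HasTwoDerivs (fun t : ℝ => ‖y + t • e4 i‖ ^ 2) (2 * y i) 2 := by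
  have h : (fun t : ℝ => ‖y + t • e4 i‖ ^ 2) = fun t : ℝ => ‖y‖ ^ 2 + (t * (2 * y i) + t ^ 2) := by
    ext t
    rw [norm_add_sq_real, norm_smul, inner_smul_right]
    simp [EuclideanSpace.inner_single_right]
    ring
  rw [h]
  refine ⟨fun t => 2 * y i + 2 * t, .of_forall fun t => ?_, by simp, ?_⟩
  · refine (((hasDerivAt_id t).mul_const (2 * y i)).add (hasDerivAt_pow 2 t)).const_add (‖y‖ ^ 2)
      |>.congr_deriv ?_
    simp
  · simpa using ((hasDerivAt_id (0 : ℝ)).const_mul 2).const_add (2 * y i)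

theorem hasTwoDerivs_norm {y : E4} (hy : y ≠ 0) (i : Fin 4) :
    HasTwoDerivs (fun t : ℝ => ‖y + t • e4 i‖) (y i / ‖y‖)
      (1 / ‖y‖ - (y i) ^ 2 / ‖y‖ ^ 3) := by
  have hr : 0 < ‖y‖ := norm_pos_iff.2 hy
  have h := (hasTwoDerivs_norm_sq y i).comp_real (φ := Real.sqrt)
    (φ' := fun s => 1 / (2 * √s)) (φ₂ := - 1 / (4 * ‖y‖ ^ 3)) ?_ ?_
  · simp only [Real.sqrt_sq (norm_nonneg _), zero_smul, add_zero] at h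
    convert h using 1 <;> field_simp
    ring
  · simp only [zero_smul, add_zero]
    filter_upwards [lt_mem_nhds (show 0 < ‖y‖ ^ 2 by positivity)] with s hs
    exact Real.hasDerivAt_sqrt hs.ne'
  · simp only [zero_smul, add_zero]
    have := ((Real.hasDerivAt_sqrt (show ‖y‖ ^ 2 ≠ 0 by positivity)).const_mul 2).inv
      (by rw [Real.sqrt_sq hr.le]; positivity)
    simp only [one_div]
    refine this.congr_deriv ?_
    rw [Real.sqrt_sq hr.le]
    field_simp
    norm_num

theorem hasTwoDerivs_inv_norm_sq {y : E4} (hy : y ≠ 0) (i : Fin 4) :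
    HasTwoDerivs (fun t : ℝ => (‖y + t • e4 i‖ ^ 2)⁻¹) (- 2 * y i / ‖y‖ ^ 4)
      (8 * (y i) ^ 2 / ‖y‖ ^ 6 - 2 / ‖y‖ ^ 4) := by
  have hr : 0 < ‖y‖ := norm_pos_iff.2 hy
  have h := (hasTwoDerivs_norm_sq y i).comp_real (φ := fun s => s⁻¹)
    (φ' := fun s => -(s ^ 2)⁻¹) (φ₂ := 2 / ‖y‖ ^ 6) ?_ ?_
  · simp only [zero_smul, add_zero] at h
    convert h using 1 <;> field_simp
    ring
  · simp only [zero_smul, add_zero]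
    filter_upwards [lt_mem_nhds (show 0 < ‖y‖ ^ 2 by positivity)] with s hs
    exact hasDerivAt_inv hs.ne'
  · simp only [zero_smul, add_zero]
    have := ((hasDerivAt_pow 2 (‖y‖ ^ 2)).inv (by positivity)).neg
    refine this.congr_deriv ?_
    field_simp
    norm_num [mul_comm]

theorem sum_sq_coord (y : E4) : ∑ i, (y i) ^ 2 = ‖y‖ ^ 2 := by
  simp [EuclideanSpace.norm_sq_eq]

theorem sum_coord_smul (y : E4) : ∑ i, y i • e4 i = y := by
  ext j
  fin_cases j <;> simp [Fin.sum_univ_four]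

/-- At a local minimum of `u - u^λ - q |·|`, where `u^λ` is the Kelvin transform of `u` about `x`,
the Laplacian of this function, computed by conformal covariance, is nonnegative. -/
theorem kelvin_lap_nonneg {u : E4 → ℝ} {x y : E4} {l q : ℝ} (hy : y ≠ 0)
    (h1 : ContDiffAt ℝ 2 u (x + y))
    (h2 : ContDiffAt ℝ 2 u (x + (l ^ 2 * (‖y‖ ^ 2)⁻¹) • y))
    (hmin : IsLocalMin (fun z => u (x + z) -
      (l ^ 2 * (‖z‖ ^ 2)⁻¹) * u (x + (l ^ 2 * (‖z‖ ^ 2)⁻¹) • z) - q * ‖z‖) y) :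
    0 ≤ lap u (x + y) - (l ^ 2 * (‖y‖ ^ 2)⁻¹) ^ 3 * lap u (x + (l ^ 2 * (‖y‖ ^ 2)⁻¹) • y)
      - 3 * q / ‖y‖ := by
  have hr : 0 < ‖y‖ := norm_pos_iff.2 hy
  rw [lap_eq_sum_s1 h1, lap_eq_sum_s1 h2]
  set k := l ^ 2 * (‖y‖ ^ 2)⁻¹ with hk
  set L := fderiv ℝ u (x + k • y) with hL
  set B := fderiv ℝ (fderiv ℝ u) (x + k • y) with hB
  set B' := fderiv ℝ (fderiv ℝ u) (x + y) with hB'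
  set P : Fin 4 → ℝ := fun i => l ^ 2 * (- 2 * y i / ‖y‖ ^ 4)
  set Q : Fin 4 → ℝ := fun i => l ^ 2 * (8 * (y i) ^ 2 / ‖y‖ ^ 6 - 2 / ‖y‖ ^ 4)
  have key : ∀ i, 0 ≤ B' (e4 i) (e4 i)
      - (k * (B (k • e4 i + P i • y) (k • e4 i + P i • y) + L ((2 * P i) • e4 i + Q i • y))
        + (2 * P i) * L (k • e4 i + P i • y) + Q i * u (x + k • y))
      - q * (1 / ‖y‖ - (y i) ^ 2 / ‖y‖ ^ 3) := by
    intro i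
    have hline := HasTwoDerivs.line y (e4 i)
    have hkap := (hasTwoDerivs_inv_norm_sq hy i).const_smul (l ^ 2)
    have ha := ((HasTwoDerivs.const x).add hline).comp (u := u) (by simpa using h1)
    have hg := ((HasTwoDerivs.const x).add (hkap.smul hline)).comp (u := u)
      (by simpa using h2)
    have hF := (ha.sub (hkap.smul hg)).sub ((hasTwoDerivs_norm hy i).const_smul q)
    have := hF.nonneg_of_isLocalMin ?_
    · simp only [zero_smul, add_zero, zero_add, smul_eq_mul, smul_zero, map_zero] at this
      exact this
    · have hc : Tendsto (fun t : ℝ => y + t • e4 i) (𝓝 0) (𝓝 y) := by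
        have : Continuous (fun t : ℝ => y + t • e4 i) := by fun_prop
        simpa using this.tendsto 0
      have := hc.eventually hmin
      filter_upwards [this] with t ht
      simpa using ht
  have hsum := Finset.sum_nonneg fun i (_ : i ∈ Finset.univ) => key i
  have hn := sum_sq_coord y
  have hLy : L y = ∑ i, y i * L (e4 i) := by
    conv_lhs => rw [← sum_coord_smul y]
    simp
  have hBr : B y y = ∑ i, y i * B y (e4 i) := by
    conv_lhs => enter [2]; rw [← sum_coord_smul y]
    simp
  have hBl : B y y = ∑ i, y i * B (e4 i) y := by
    conv_lhs => enter [1, 2]; rw [← sum_coord_smul y]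
    simp
  refine hsum.trans_eq ?_
  obtain ⟨v, hv⟩ : ∃ v, v = ‖y‖⁻¹ := ⟨_, rfl⟩
  have hP : ∀ i, P i = -2 * k * v ^ 2 * y i := fun i => by
    simp only [P, hk, hv]; field_simp
  have hQ : ∀ i, Q i = k * (8 * (y i) ^ 2 * v ^ 4 - 2 * v ^ 2) := fun i => by
    simp only [Q, hk, hv]; field_simp
  have hs : v ^ 2 * ∑ i, (y i) ^ 2 = 1 := by rw [hn, hv]; field_simp
  have hq : ∀ a : ℝ, a / ‖y‖ ^ 3 = a * v ^ 3 := fun a => by rw [hv]; field_simp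
  have hq' : ∀ a : ℝ, a / ‖y‖ = a * v := fun a => by rw [hv]; field_simp
  simp only [hP, hQ, hq, hq', map_add, map_smul, add_apply, smul_apply,
    smul_eq_mul, Fin.sum_univ_four] at hs hLy hBr hBl ⊢
  linear_combination (-2 * k ^ 3 * v ^ 2) * hBr - 2 * k ^ 3 * v ^ 2 * hBl - 8 * k ^ 2 * v ^ 2 * hLy
    + (-4 * k ^ 3 * v ^ 2 * B y y - 16 * k ^ 2 * v ^ 2 * L y - 8 * k * v ^ 2 * u (x + k • y)
      + q * v) * hs

/-- The equation at a touching point: with `w = u`, `k * v` the Kelvin transform and `s` the distance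
to the centre, the Laplacian of the comparison function is negative. -/
theorem touching_lt {A N Λ q δ ρ k v w s a hv hw : ℝ} (hA : 0 < A) (hq : 0 < q)
    (hδ : 0 < δ) (hw0 : 0 < w) (hv0 : 0 < v) (hkN : v ≤ N) (h3 : 0 < k) (h2 : k ≤ 1)
    (ha : 0 < a) (hs : 0 < s) (has : a ≤ s) (hsρ : s ≤ ρ) (hkr : k * s ≤ Λ)
    (hwA : hw ≤ A) (hvA : -A ≤ hv)
    (hw_eq : w = k * v + q * (s - a) - δ) (hAρ : A * ρ ^ 2 ≤ 1) (hqN : 2 * A * N * Λ ≤ q)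
    (hδq : 24 * N ^ 2 * δ * ρ < q) :
    hw * w - 8 * w ^ 3 - k ^ 3 * (hv * v - 8 * v ^ 3) - 3 * q / s < 0 := by
  have hN : 0 < N := hv0.trans_le hkN
  by_contra! hlap
  have b0 : 0 < k * v := by positivity
  have bN : k * v ≤ N := (mul_le_of_le_one_left hv0.le h2).trans hkN
  have c1 : hw * w ≤ A * (k * v + q * s) := by
    calc hw * w ≤ A * w := by gcongr
      _ ≤ A * (k * v + q * s) := by gcongr; nlinarith
  have c2 : -(k ^ 3 * (hv * v)) ≤ A * (k * v) := by
    have : -(k ^ 3 * (hv * v)) = k ^ 2 * (k * v) * (-hv) := by ring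
    rw [this]
    calc k ^ 2 * (k * v) * (-hv) ≤ k ^ 2 * (k * v) * A := by gcongr; linarith
      _ ≤ 1 ^ 2 * (k * v) * A := by gcongr
      _ = A * (k * v) := by ring
  have c3 : (k * v) ^ 3 - w ^ 3 ≤ 3 * N ^ 2 * δ := by
    have hwd : k * v ≤ w + δ := by nlinarith [mul_nonneg hq.le (sub_nonneg.2 has)]
    by_cases hc : k * v ≤ w
    · have : (k * v) ^ 3 ≤ w ^ 3 := by gcongr
      have : 0 ≤ 3 * N ^ 2 * δ := by positivity
      linarith
    · push Not at hc
      have hs : (k * v) ^ 2 + k * v * w + w ^ 2 ≤ 3 * N ^ 2 := by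
        have hwN : w ≤ N := hc.le.trans bN
        have : (k * v) ^ 2 ≤ N ^ 2 := by gcongr
        have : w ^ 2 ≤ N ^ 2 := by gcongr
        have : k * v * w ≤ N * N := by gcongr
        linarith
      calc (k * v) ^ 3 - w ^ 3 = (k * v - w) * ((k * v) ^ 2 + k * v * w + w ^ 2) := by ring
        _ ≤ δ * (3 * N ^ 2) := by gcongr; linarith
        _ = 3 * N ^ 2 * δ := by ring
  have c4 : 0 ≤ 2 * A * (k * v) + A * q * s + 24 * N ^ 2 * δ - 3 * q / s := by
    refine hlap.trans ?_
    have : (k * v) ^ 3 = k ^ 3 * v ^ 3 := by ring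
    linarith
  have c5 : 0 ≤ (2 * A * (k * v) + A * q * s + 24 * N ^ 2 * δ - 3 * q / s) * s := by positivity
  have c6 : (2 * A * (k * v) + A * q * s + 24 * N ^ 2 * δ - 3 * q / s) * s =
    2 * A * v * (k * s) + q * (A * s ^ 2) + 24 * N ^ 2 * δ * s - 3 * q := by field_simp
  have c7 : 2 * A * v * (k * s) ≤ 2 * A * N * Λ := by gcongr
  have c8 : q * (A * s ^ 2) ≤ q * 1 := by
    gcongr
    exact (by gcongr : A * s ^ 2 ≤ A * ρ ^ 2).trans hAρ
  have c9 : 24 * N ^ 2 * δ * s ≤ 24 * N ^ 2 * δ * ρ := by gcongr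
  linarith

/-- Approximate comparison with the Kelvin transform; the slack `δ` keeps the comparison function
positive on the reflecting sphere, so that no boundary point lemma is needed. -/
theorem kelvin_le_add {Ω : Set E4} (hΩ : IsOpen Ω) {u h : E4 → ℝ} {x : E4} {A m ρ Λ N q δ : ℝ}
    (hball : closedBall x ρ ⊆ Ω) (hA : 0 < A) (hm : 0 < m) (hΛ : 0 < Λ) (hΛρ : Λ < ρ) (hq : 0 < q)
    (hh : ∀ z ∈ Ω, |h z| ≤ A) (hu : ContDiffOn ℝ 2 u Ω)
    (heq : ∀ z ∈ Ω, -lap u z + h z * u z = 8 * (u z) ^ 3) (hum : ∀ z ∈ Ω, m ≤ u z)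
    (huN : ∀ z ∈ closedBall x Λ, u z ≤ N) (hAρ : A * ρ ^ 2 ≤ 1) (hqN : 2 * A * N * Λ ≤ q)
    (hbd : N * Λ ^ 2 / ρ ^ 2 + q * ρ ≤ m) (hδ : 0 < δ) (hδq : 24 * N ^ 2 * δ * ρ < q)
    {l : ℝ} (hl : 0 < l) (hlΛ : l ≤ Λ) {y : E4} (hly : l ≤ ‖y‖) (hyρ : ‖y‖ ≤ ρ) :
    (l ^ 2 * (‖y‖ ^ 2)⁻¹) * u (x + (l ^ 2 * (‖y‖ ^ 2)⁻¹) • y) ≤ u (x + y) + δ := by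
  have hρ : 0 < ρ := hΛ.trans hΛρ
  have hmem : ∀ z : E4, ‖z‖ ≤ ρ → x + z ∈ Ω := fun z hz => hball (by simpa using hz)
  have hcu : ContinuousOn u Ω := hu.continuousOn
  have hNm : m ≤ N := (hum x (hball (by simp [hρ.le]))).trans (huN x (by simp [hΛ.le]))
  have hN : 0 < N := hm.trans_le hNm
  have hkn : ∀ (l : ℝ) (z : E4), 0 < l → l ≤ ‖z‖ →
      ‖(l ^ 2 * (‖z‖ ^ 2)⁻¹) • z‖ ≤ l ∧ l ^ 2 * (‖z‖ ^ 2)⁻¹ ≤ 1 ∧ 0 < l ^ 2 * (‖z‖ ^ 2)⁻¹ := by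
    intro l z hl hz
    have hz0 : 0 < ‖z‖ := hl.trans_le hz
    refine ⟨?_, ?_, by positivity⟩
    · rw [norm_smul, Real.norm_of_nonneg (by positivity)]
      have : l ^ 2 * (‖z‖ ^ 2)⁻¹ * ‖z‖ = l * (l / ‖z‖) := by field_simp
      rw [this]
      exact mul_le_of_le_one_right hl.le ((div_le_one hz0).2 hz)
    · rw [← div_eq_mul_inv, div_le_one (by positivity)]
      gcongr
  set F : ℝ × E4 → ℝ := fun p => u (x + p.2) -
    (p.1 ^ 2 * (‖p.2‖ ^ 2)⁻¹) * u (x + (p.1 ^ 2 * (‖p.2‖ ^ 2)⁻¹) • p.2) - q * (‖p.2‖ - p.1) + δ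
    with hF
  obtain ⟨r, hr, hrosc, hrq⟩ : ∃ r > 0, (∀ z : E4, ‖z‖ ≤ r → |u (x + z) - u x| < δ / 4) ∧
      q * r ≤ δ / 4 := by
    have hcx : ContinuousAt u x := hcu.continuousAt (hΩ.mem_nhds (hball (by simp [hρ.le])))
    obtain ⟨r, hr, hr'⟩ := Metric.continuousAt_iff.1 hcx (δ / 4) (by positivity)
    refine ⟨min (r / 2) (δ / 4 / q), lt_min (by positivity) (by positivity), fun z hz => ?_, ?_⟩
    · have : ‖z‖ < r := (hz.trans (min_le_left _ _)).trans_lt (by linarith)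
      simpa [Real.dist_eq] using @hr' (x + z) (by simpa using this)
    · calc q * min (r / 2) (δ / 4 / q) ≤ q * (δ / 4 / q) := by gcongr; exact min_le_right _ _
        _ = δ / 4 := by field_simp
  -- The comparison holds on spheres of small radius.
  obtain ⟨l₀, hl₀, hl₀l, hstart⟩ : ∃ l₀ > 0, l₀ ≤ l ∧
      ∀ z : E4, l₀ ≤ ‖z‖ → ‖z‖ ≤ ρ → 0 < F (l₀, z) := by
    refine ⟨min l (r * Λ / ρ), lt_min hl (by positivity), min_le_left _ _, fun z hz hzρ => ?_⟩
    set l₀ := min l (r * Λ / ρ) with hl₀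
    have hl₀0 : 0 < l₀ := lt_min hl (by positivity)
    obtain ⟨h1, h2, h3⟩ := hkn l₀ z hl₀0 hz
    set k := l₀ ^ 2 * (‖z‖ ^ 2)⁻¹ with hk
    have hkΛ : ‖k • z‖ ≤ Λ := h1.trans ((min_le_left _ _).trans hlΛ)
    have hkN : u (x + k • z) ≤ N := huN _ (by simpa using hkΛ)
    have hkm : m ≤ u (x + k • z) := hum _ (hmem _ (hkΛ.trans hΛρ.le))
    simp only [hF]
    rw [← hk]
    by_cases hzr : ‖z‖ ≤ r
    · have ha := abs_lt.1 (hrosc z hzr)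
      have hb := abs_lt.1 (hrosc (k • z) ((h1.trans hz).trans hzr))
      have hc : k * u (x + k • z) ≤ u (x + k • z) :=
        mul_le_of_le_one_left (hm.le.trans hkm) h2
      have hd : q * (‖z‖ - l₀) ≤ q * r := by gcongr; linarith
      linarith
    · push Not at hzr
      have hz0 : 0 < ‖z‖ := hr.trans hzr
      have hk' : k ≤ Λ ^ 2 / ρ ^ 2 := by
        rw [hk, ← div_eq_mul_inv, div_le_div_iff₀ (by positivity) (by positivity)]
        have : l₀ * ρ ≤ Λ * ‖z‖ := by
          calc l₀ * ρ ≤ r * Λ / ρ * ρ := by gcongr; exact min_le_right _ _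
            _ = Λ * r := by field_simp
            _ ≤ Λ * ‖z‖ := by gcongr
        calc l₀ ^ 2 * ρ ^ 2 = (l₀ * ρ) ^ 2 := by ring
          _ ≤ (Λ * ‖z‖) ^ 2 := by gcongr
          _ = Λ ^ 2 * ‖z‖ ^ 2 := by ring
      have hc : k * u (x + k • z) ≤ Λ ^ 2 / ρ ^ 2 * N := by gcongr; linarith
      have hd : q * (‖z‖ - l₀) ≤ q * ρ := by gcongr; linarith
      have he := hum _ (hmem z hzρ)
      have hf : Λ ^ 2 / ρ ^ 2 * N = N * Λ ^ 2 / ρ ^ 2 := by ring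
      linarith
  set T : Set (ℝ × E4) := {p | l₀ ≤ p.1 ∧ p.1 ≤ Λ ∧ p.1 ≤ ‖p.2‖ ∧ ‖p.2‖ ≤ ρ} with hT
  have hTclosed : IsClosed T := by
    have h₁ : Continuous fun p : ℝ × E4 => p.1 := continuous_fst
    have h₂ : Continuous fun p : ℝ × E4 => ‖p.2‖ := continuous_snd.norm
    exact (isClosed_le continuous_const h₁).inter ((isClosed_le h₁ continuous_const).inter
      ((isClosed_le h₁ h₂).inter (isClosed_le h₂ continuous_const)))
  have hTcompact : IsCompact T := by
    refine (isCompact_Icc (a := l₀) (b := Λ)).prod (isCompact_closedBall (0 : E4) ρ)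
      |>.of_isClosed_subset hTclosed ?_
    rintro ⟨a, z⟩ ⟨h1, h2, h3, h4⟩
    exact ⟨⟨h1, h2⟩, by simpa using h4⟩
  have hFcont : ContinuousOn F T := by
    have hkc : ContinuousOn (fun p : ℝ × E4 => p.1 ^ 2 * (‖p.2‖ ^ 2)⁻¹) T := by
      refine ContinuousOn.mul (by fun_prop) (ContinuousOn.inv₀ (by fun_prop) ?_)
      rintro ⟨a, z⟩ ⟨h1, h2, h3, h4⟩
      have : 0 < ‖z‖ := hl₀.trans_le (h1.trans h3)
      simp only
      positivity
    have hc1 : ContinuousOn (fun p : ℝ × E4 => u (x + p.2)) T :=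
      hcu.comp (f := fun p : ℝ × E4 => x + p.2) (by fun_prop) fun p hp => hmem _ hp.2.2.2
    have hc2 : ContinuousOn
        (fun p : ℝ × E4 => u (x + (p.1 ^ 2 * (‖p.2‖ ^ 2)⁻¹) • p.2)) T :=
      hcu.comp (f := fun p : ℝ × E4 => x + (p.1 ^ 2 * (‖p.2‖ ^ 2)⁻¹) • p.2)
        (continuousOn_const.add (hkc.smul continuousOn_snd)) fun p hp =>
          hmem _ (((hkn p.1 p.2 (hl₀.trans_le hp.1) hp.2.2.1).1.trans hp.2.1).trans hΛρ.le)
    exact ((hc1.sub (hkc.mul hc2)).sub (by fun_prop)).add continuousOn_const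
  have hpos : ∀ p ∈ T, 0 < F p := by
    by_contra! hbad
    have hSclosed : IsClosed (T ∩ F ⁻¹' Set.Iic 0) :=
      hFcont.preimage_isClosed_of_isClosed hTclosed isClosed_Iic
    obtain ⟨⟨a, z⟩, ⟨⟨ha0, haΛ, haz, hzρ⟩, hFle⟩, hmin⟩ :=
      (hTcompact.of_isClosed_subset hSclosed Set.inter_subset_left).exists_isMinOn
        (let ⟨p, hp, hp'⟩ := hbad; ⟨p, hp, hp'⟩) (f := Prod.fst) continuousOn_fst
    simp only at ha0 haΛ haz hzρ
    have hlt : ∀ b w, l₀ ≤ b → b < a → b ≤ ‖w‖ → ‖w‖ ≤ ρ → 0 < F (b, w) := by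
      intro b w h1 h2 h3 h4
      by_contra! h5
      have := hmin (show (b, w) ∈ T ∩ F ⁻¹' Set.Iic 0 from ⟨⟨h1, h2.le.trans haΛ, h3, h4⟩, h5⟩)
      simp only [Set.mem_ofPred_eq] at this
      linarith
    have hla : l₀ < a := by
      refine lt_of_le_of_ne ha0 fun h => ?_
      subst h
      exact (hstart z haz hzρ).not_ge hFle
    have ha : 0 < a := hl₀.trans hla
    have hge : ∀ w, a ≤ ‖w‖ → ‖w‖ ≤ ρ → 0 ≤ F (a, w) := by
      intro w h3 h4
      have ht : Tendsto (fun b => (b, w)) (𝓝[<] a) (𝓝[T] (a, w)) := by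
        refine tendsto_nhdsWithin_iff.2 ⟨?_, ?_⟩
        · have : Continuous fun b : ℝ => (b, w) := by fun_prop
          exact (this.tendsto a).mono_left nhdsWithin_le_nhds
        · filter_upwards [Ioo_mem_nhdsLT hla] with b hb
          exact ⟨hb.1.le, hb.2.le.trans haΛ, hb.2.le.trans h3, h4⟩
      refine ge_of_tendsto ((hFcont (a, w) ⟨ha0, haΛ, h3, h4⟩).tendsto.comp ht) ?_
      filter_upwards [Ioo_mem_nhdsLT hla] with b hb
      exact (hlt b w hb.1.le hb.2 (hb.2.le.trans h3) h4).le
    have hz0 : 0 < ‖z‖ := ha.trans_le haz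
    obtain ⟨h1, h2, h3⟩ := hkn a z ha haz
    have hF0 : F (a, z) = 0 := le_antisymm hFle (hge z haz hzρ)
    have hFv : F (a, z) = u (x + z) - (a ^ 2 * (‖z‖ ^ 2)⁻¹) *
      u (x + (a ^ 2 * (‖z‖ ^ 2)⁻¹) • z) - q * (‖z‖ - a) + δ := rfl
    have hkΛ : ‖(a ^ 2 * (‖z‖ ^ 2)⁻¹) • z‖ ≤ Λ := h1.trans haΛ
    have hkN : u (x + (a ^ 2 * (‖z‖ ^ 2)⁻¹) • z) ≤ N := huN _ (by simpa using hkΛ)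
    have hkΩ : x + (a ^ 2 * (‖z‖ ^ 2)⁻¹) • z ∈ Ω := hmem _ (hkΛ.trans hΛρ.le)
    have hkm : m ≤ u (x + (a ^ 2 * (‖z‖ ^ 2)⁻¹) • z) := hum _ hkΩ
    have hzΩ := hmem z hzρ
    have hzm := hum _ hzΩ
    -- The touching point lies on neither boundary sphere.
    have haz' : a < ‖z‖ := by
      refine lt_of_le_of_ne haz fun h => ?_
      have hk1 : a ^ 2 * (‖z‖ ^ 2)⁻¹ = 1 := by rw [← h]; field_simp
      rw [hk1, ← h] at hFv
      simp at hFv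
      linarith
    have hzρ' : ‖z‖ < ρ := by
      refine lt_of_le_of_ne hzρ fun h => ?_
      have hc : (a ^ 2 * (‖z‖ ^ 2)⁻¹) * u (x + (a ^ 2 * (‖z‖ ^ 2)⁻¹) • z) ≤
          (Λ ^ 2 * (ρ ^ 2)⁻¹) * N := by
        have : a ^ 2 * (‖z‖ ^ 2)⁻¹ ≤ Λ ^ 2 * (ρ ^ 2)⁻¹ := by rw [h]; gcongr
        gcongr
        linarith
      have hd : q * (‖z‖ - a) ≤ q * ρ := by gcongr; linarith
      have hf : (Λ ^ 2 * (ρ ^ 2)⁻¹) * N = N * Λ ^ 2 / ρ ^ 2 := by ring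
      linarith
    have hlocmin : IsLocalMin (fun z => u (x + z) -
      (a ^ 2 * (‖z‖ ^ 2)⁻¹) * u (x + (a ^ 2 * (‖z‖ ^ 2)⁻¹) • z) - q * ‖z‖) z := by
      have hopen : ∀ᶠ w : E4 in 𝓝 z, a < ‖w‖ ∧ ‖w‖ < ρ :=
        (continuous_norm.continuousAt.eventually (lt_mem_nhds haz')).and
          (continuous_norm.continuousAt.eventually (gt_mem_nhds hzρ'))
      filter_upwards [hopen] with w hw
      have := hge w hw.1.le hw.2.le
      simp only [hF] at this
      linarith
    have hlap := kelvin_lap_nonneg (norm_pos_iff.1 hz0) (hu.contDiffAt (hΩ.mem_nhds hzΩ))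
      (hu.contDiffAt (hΩ.mem_nhds hkΩ)) hlocmin
    have hkr : (a ^ 2 * (‖z‖ ^ 2)⁻¹) * ‖z‖ ≤ Λ := by
      rw [norm_smul, Real.norm_of_nonneg h3.le] at hkΛ
      exact hkΛ
    have hlap_eq : ∀ p, x + p ∈ Ω → lap u (x + p) = h (x + p) * u (x + p) - 8 * u (x + p) ^ 3 :=
      fun p hp => by linarith [heq _ hp]
    rw [hlap_eq _ hzΩ, hlap_eq _ hkΩ] at hlap
    exact hlap.not_gt (touching_lt hA hq hδ (hm.trans_le hzm) (hm.trans_le hkm) hkN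
      h3 h2 ha hz0 haz hzρ hkr (abs_le.1 (hh _ hzΩ)).2 (abs_le.1 (hh _ hkΩ)).1 (by linarith) hAρ
      hqN hδq)
  have := hpos (l, y) ⟨hl₀l, hlΛ, hly, hyρ⟩
  have hqy : 0 ≤ q * (‖y‖ - l) := mul_nonneg hq.le (sub_nonneg.2 hly)
  simp only [hF] at this
  linarith

/-- Method of moving spheres: `u` dominates its Kelvin transform about `x` outside every sphere of
radius at most `Λ`. -/
theorem kelvin_le {Ω : Set E4} (hΩ : IsOpen Ω) {u h : E4 → ℝ} {x : E4} {A m ρ Λ N q : ℝ}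
    (hball : closedBall x ρ ⊆ Ω) (hA : 0 < A) (hm : 0 < m) (hΛ : 0 < Λ) (hΛρ : Λ < ρ) (hq : 0 < q)
    (hh : ∀ z ∈ Ω, |h z| ≤ A) (hu : ContDiffOn ℝ 2 u Ω)
    (heq : ∀ z ∈ Ω, -lap u z + h z * u z = 8 * (u z) ^ 3) (hum : ∀ z ∈ Ω, m ≤ u z)
    (huN : ∀ z ∈ closedBall x Λ, u z ≤ N) (hAρ : A * ρ ^ 2 ≤ 1) (hqN : 2 * A * N * Λ ≤ q)
    (hbd : N * Λ ^ 2 / ρ ^ 2 + q * ρ ≤ m)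
    {l : ℝ} (hl : 0 < l) (hlΛ : l ≤ Λ) {y : E4} (hly : l ≤ ‖y‖) (hyρ : ‖y‖ ≤ ρ) :
    (l ^ 2 * (‖y‖ ^ 2)⁻¹) * u (x + (l ^ 2 * (‖y‖ ^ 2)⁻¹) • y) ≤ u (x + y) := by
  have hev : ∀ᶠ δ : ℝ in 𝓝[>] 0, 24 * N ^ 2 * δ * ρ < q := by
    have : Continuous fun δ : ℝ => 24 * N ^ 2 * δ * ρ := by fun_prop
    exact nhdsWithin_le_nhds (this.continuousAt.eventually (gt_mem_nhds (by simpa using hq)))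
  have ht : Tendsto (fun δ : ℝ => u (x + y) + δ) (𝓝[>] 0) (𝓝 (u (x + y))) := by
    have : Continuous fun δ : ℝ => u (x + y) + δ := by fun_prop
    have h0 := this.tendsto 0
    rw [add_zero] at h0
    exact h0.mono_left nhdsWithin_le_nhds
  refine ge_of_tendsto ht ?_
  filter_upwards [hev, self_mem_nhdsWithin] with δ h1 h2
  exact kelvin_le_add hΩ hball hA hm hΛ hΛρ hq hh hu heq hum huN hAρ hqN hbd h2 h1 hl hlΛ hly hyρ

theorem lap_add_nonneg_of_isLocalMin {u : E4 → ℝ} {x₀ y : E4} {c : ℝ}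
    (hu : ContDiffAt ℝ 2 u y)
    (hmin : IsLocalMin (fun z => u z + c * ‖z - x₀‖ ^ 2) y) : 0 ≤ lap u y + 8 * c := by
  have key : ∀ i, 0 ≤ fderiv ℝ (fderiv ℝ u) y (e4 i) (e4 i) + c * 2 := by
    intro i
    have ha := (HasTwoDerivs.line y (e4 i)).comp (u := u) (by simpa using hu)
    have hF := ha.add ((hasTwoDerivs_norm_sq (y - x₀) i).const_smul c)
    have := hF.nonneg_of_isLocalMin ?_
    · simpa using this
    · have hc : Tendsto (fun t : ℝ => y + t • e4 i) (𝓝 0) (𝓝 y) := by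
        have : Continuous (fun t : ℝ => y + t • e4 i) := by fun_prop
        simpa using this.tendsto 0
      filter_upwards [hc.eventually hmin] with t ht
      simpa [sub_add_eq_add_sub] using ht
  have hsum := Finset.sum_nonneg fun i (_ : i ∈ Finset.univ) => key i
  rw [Finset.sum_add_distrib, ← lap_eq_sum_s1 hu] at hsum
  simp at hsum
  linarith

/-- Weak minimum principle on a ball: a strictly negative Laplacian forces a drop from the boundary
values towards the centre. -/
theorem le_of_lap_lt {u : E4 → ℝ} {x₀ : E4} {c d b : ℝ} (hd : 0 < d)
    (hu : ∀ y ∈ closedBall x₀ d, ContDiffAt ℝ 2 u y)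
    (hlap : ∀ y ∈ closedBall x₀ d, lap u y + 8 * c < 0) (hb : ∀ y ∈ closedBall x₀ d, b ≤ u y) :
    b + c * d ^ 2 ≤ u x₀ := by
  have hcont : ContinuousOn (fun z => u z + c * ‖z - x₀‖ ^ 2) (closedBall x₀ d) :=
    ContinuousOn.add (fun y hy => (hu y hy).continuousAt.continuousWithinAt) (by fun_prop)
  obtain ⟨y, hy, hmin⟩ := (isCompact_closedBall x₀ d).exists_isMinOn
    ⟨x₀, mem_closedBall_self hd.le⟩ hcont
  have hyd : ‖y - x₀‖ = d := by
    refine (mem_closedBall_iff_norm.1 hy).eq_of_not_lt fun hlt => ?_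
    have hnhds : closedBall x₀ d ∈ 𝓝 y :=
      mem_of_superset (isOpen_ball.mem_nhds (mem_ball_iff_norm.2 hlt)) ball_subset_closedBall
    exact (lap_add_nonneg_of_isLocalMin (hu y hy) (hmin.isLocalMin hnhds)).not_gt
      (hlap y hy)
  have h0 : u y + c * ‖y - x₀‖ ^ 2 ≤ u x₀ + c * ‖x₀ - x₀‖ ^ 2 :=
    hmin (mem_closedBall_self hd.le)
  rw [hyd] at h0
  simp at h0
  linarith [hb y hy]

/-- At a point `x₀` where `u` is large and controls `u` nearby, moving spheres give a Harnack
inequality at scale `1 / u x₀`. -/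
theorem half_le_of_kelvin_le {u : E4 → ℝ} {x₀ z : E4} {d Λ ρ : ℝ} (hΛ : √2 * d ≤ Λ)
    (hρ : 2 * d ≤ ρ) (hz : z ∈ closedBall x₀ d) (hu0 : 0 < u x₀)
    (hk : ∀ x ∈ closedBall x₀ d, ∀ l > 0, l ≤ Λ → ∀ y : E4, l ≤ ‖y‖ → ‖y‖ ≤ ρ →
      (l ^ 2 * (‖y‖ ^ 2)⁻¹) * u (x + (l ^ 2 * (‖y‖ ^ 2)⁻¹) • y) ≤ u (x + y)) :
    u x₀ / 2 ≤ u z := by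
  rcases eq_or_ne z x₀ with rfl | hne
  · linarith
  set v := z - x₀ with hv
  have hr : 0 < ‖v‖ := norm_pos_iff.2 (sub_ne_zero.2 hne)
  have hrd : ‖v‖ ≤ d := mem_closedBall_iff_norm.1 hz
  have h2 : √2 ^ 2 = (2 : ℝ) := Real.sq_sqrt (by norm_num)
  have hs : √2 ≤ (2 : ℝ) := by nlinarith [Real.sqrt_nonneg 2]
  have hn : ‖(2 : ℝ) • v‖ = 2 * ‖v‖ := by rw [norm_smul]; simp
  have := hk (x₀ - v) (by simpa [mem_closedBall_iff_norm] using hrd) (√2 * ‖v‖) (by positivity)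
    ((by gcongr : √2 * ‖v‖ ≤ √2 * d).trans hΛ) ((2 : ℝ) • v) (by rw [hn]; gcongr)
    (by rw [hn]; linarith)
  have hk2 : (√2 * ‖v‖) ^ 2 * (‖(2 : ℝ) • v‖ ^ 2)⁻¹ = 1 / 2 := by
    rw [hn, mul_pow, h2]; field_simp
  rw [hk2, smul_smul, show x₀ - v + (1 / 2 * 2 : ℝ) • v = x₀ by norm_num,
    show x₀ - v + (2 : ℝ) • v = z by rw [two_smul, hv]; abel] at this
  linarith

/-- Point selection: a large value at `p` yields a point `x₀` whose value `u x₀` controls `u` on a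
ball that is large at scale `1 / u x₀`. -/
theorem exists_almost_max {u : E4 → ℝ} {p : E4} {R k : ℝ} (hR : 0 < R)
    (hu : ContinuousOn u (closedBall p R)) (hpos : ∀ z ∈ closedBall p R, 0 < u z)
    (hk : 2 * k ≤ u p * R) :
    ∃ x₀ ∈ closedBall p R, u p ≤ u x₀ ∧
      ∀ z ∈ closedBall x₀ (k / u x₀), z ∈ closedBall p R ∧ u z ≤ 2 * u x₀ := by
  obtain ⟨x₀, hx₀, hmax⟩ := (isCompact_closedBall p R).exists_isMaxOn
    ⟨p, mem_closedBall_self hR.le⟩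
    (hu.mul (by fun_prop : ContinuousOn (fun z => R - dist z p) (closedBall p R)))
  have hmax' : ∀ z ∈ closedBall p R, u z * (R - dist z p) ≤ u x₀ * (R - dist x₀ p) := hmax
  have hp := hmax' p (mem_closedBall_self hR.le)
  rw [dist_self, sub_zero] at hp
  have h0 := hpos x₀ hx₀
  have hp0 := hpos p (mem_closedBall_self hR.le)
  have hσ : 0 < R - dist x₀ p := pos_of_mul_pos_right ((mul_pos hp0 hR).trans_le hp) h0.le
  refine ⟨x₀, hx₀, ?_, fun z hz => ?_⟩
  · have : u x₀ * (R - dist x₀ p) ≤ u x₀ * R :=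
      mul_le_mul_of_nonneg_left (sub_le_self _ dist_nonneg) h0.le
    exact le_of_mul_le_mul_right (hp.trans this) hR
  · have hkσ : k / u x₀ ≤ (R - dist x₀ p) / 2 := by
      rw [div_le_iff₀ h0]; linarith
    have hzx : dist z x₀ ≤ (R - dist x₀ p) / 2 := (mem_closedBall.1 hz).trans hkσ
    have hzp : dist z p ≤ R - (R - dist x₀ p) / 2 := by linarith [dist_triangle z x₀ p]
    have hzR : z ∈ closedBall p R := mem_closedBall.2 (by linarith)
    refine ⟨hzR, ?_⟩
    have h1 : u z * ((R - dist x₀ p) / 2) ≤ u z * (R - dist z p) :=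
      mul_le_mul_of_nonneg_left (by linarith) (hpos z hzR).le
    have h2 := h1.trans (hmax' z hzR)
    refine le_of_mul_le_mul_right ?_ hσ
    linarith

/-- The pointwise bound, with all constants depending only on `A`, `m` and the distance `3 * R` to
the boundary. -/
theorem le_of_closedBall_subset {Ω : Set E4} (hΩ : IsOpen Ω) {u h : E4 → ℝ} {p : E4}
    {A m R ρ : ℝ} (hA : 0 < A) (hm : 0 < m) (hR : 0 < R) (hρ : 0 < ρ) (hρR : ρ ≤ R)
    (hball : closedBall p (3 * R) ⊆ Ω)
    (hh : ∀ z ∈ Ω, |h z| ≤ A) (hu : ContDiffOn ℝ 2 u Ω)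
    (heq : ∀ z ∈ Ω, -lap u z + h z * u z = 8 * (u z) ^ 3) (hum : ∀ z ∈ Ω, m ≤ u z)
    (hAρ : A * ρ ^ 2 ≤ 1) (hρm : 24 * A * ρ ≤ m / 2) :
    u p ≤ 24 / ρ + 144 / (m * ρ ^ 2) + 4 * A + 1 := by
  by_contra! hbig
  have t1 : 0 < 24 / ρ := by positivity
  have t2 : 0 < 144 / (m * ρ ^ 2) := by positivity
  have hsub : closedBall p R ⊆ Ω := (closedBall_subset_closedBall (by linarith)).trans hball
  have hpR : 2 * 12 ≤ u p * R := by
    have : 24 / ρ * ρ ≤ u p * R := mul_le_mul (by linarith) hρR hρ.le (by linarith)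
    rw [div_mul_cancel₀ _ hρ.ne'] at this
    linarith
  obtain ⟨x₀, hx₀, hpx, hmax⟩ := exists_almost_max hR (hu.continuousOn.mono hsub)
    (fun z hz => hm.trans_le (hum z (hsub hz))) hpR
  have hM := hbig.trans_le hpx
  set M := u x₀ with hMdef
  have hM0 : 0 < M := by linarith
  have hMρ : 6 / M < ρ / 2 := by
    have : 24 / ρ < M := by linarith
    rw [div_lt_iff₀ hρ] at this
    rw [div_lt_iff₀ hM0]
    linarith
  have hbd : 2 * M * (6 / M) ^ 2 / ρ ^ 2 + 24 * A * ρ ≤ m := by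
    have h1 : 144 / (m * ρ ^ 2) ≤ M := by linarith
    have h2 : 2 * M * (6 / M) ^ 2 / ρ ^ 2 ≤ m / 2 := by
      rw [div_le_iff₀ (by positivity)] at h1 ⊢
      have h3 : 2 * M * (6 / M) ^ 2 = 72 / M := by field_simp; norm_num
      rw [h3, div_le_iff₀ hM0]
      linarith
    linarith
  have hd6 : 3 / M + 6 / M ≤ 12 / M := by rw [← add_div]; gcongr; norm_num
  have hd3 : 3 / M ≤ 6 / M := by gcongr; norm_num
  have hkel : ∀ x ∈ closedBall x₀ (3 / M), ∀ l > 0, l ≤ 6 / M → ∀ y : E4, l ≤ ‖y‖ → ‖y‖ ≤ ρ →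
      (l ^ 2 * (‖y‖ ^ 2)⁻¹) * u (x + (l ^ 2 * (‖y‖ ^ 2)⁻¹) • y) ≤ u (x + y) := by
    intro x hx l hl hlΛ y hly hyρ
    refine kelvin_le hΩ (A := A) (m := m) (ρ := ρ) (Λ := 6 / M) (N := 2 * M) (q := 24 * A)
      ((closedBall_subset_closedBall' ?_).trans hball) hA hm (by positivity) (by linarith)
      (by positivity) hh hu heq hum (fun z hz => (hmax z ?_).2) hAρ ?_ hbd hl hlΛ hly hyρ
    · have := dist_triangle x x₀ p
      have h1 := mem_closedBall.1 hx
      have h2 := mem_closedBall.1 hx₀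
      linarith
    · have := dist_triangle z x x₀
      have h1 := mem_closedBall.1 hx
      have h2 := mem_closedBall.1 hz
      exact mem_closedBall.2 (by linarith)
    · apply le_of_eq
      field_simp
      norm_num
  have hinΩ : ∀ z ∈ closedBall x₀ (3 / M), z ∈ Ω ∧ u z ≤ 2 * M := fun z hz =>
    have h6 : 0 < 6 / M := by positivity
    have := hmax z (closedBall_subset_closedBall (by linarith) hz)
    ⟨hsub this.1, this.2⟩
  have hhalf : ∀ z ∈ closedBall x₀ (3 / M), M / 2 ≤ u z := fun z hz => by
    refine half_le_of_kelvin_le ?_ (by linarith) hz hM0 hkel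
    have hs : √2 ≤ (2 : ℝ) := Real.sqrt_le_iff.2 (by norm_num)
    calc √2 * (3 / M) ≤ 2 * (3 / M) := by gcongr
      _ = 6 / M := by ring
  have hM4 : 4 * A * M ≤ M ^ 3 := by
    have : 4 * A ≤ M ^ 2 := by nlinarith
    nlinarith
  have hdrop := le_of_lap_lt (u := u) (x₀ := x₀) (c := M ^ 3 / 17) (d := 3 / M) (b := M / 2)
    (by positivity) (fun z hz => hu.contDiffAt (hΩ.mem_nhds (hinΩ z hz).1)) (fun z hz => ?_) hhalf
  · have : M / 2 + M ^ 3 / 17 * (3 / M) ^ 2 = M + M / 34 := by field_simp; norm_num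
    rw [this] at hdrop
    linarith
  · obtain ⟨hzΩ, hz2⟩ := hinΩ z hz
    have h1 := heq z hzΩ
    have h2 := (abs_le.1 (hh z hzΩ)).2
    have h3 := hhalf z hz
    have h4 : h z * u z ≤ A * (2 * M) :=
      mul_le_mul h2 hz2 (by linarith) hA.le
    have h5 : (M / 2) ^ 3 ≤ u z ^ 3 := by gcongr
    have h6 : 0 < M ^ 3 := by positivity
    linarith

/-- Corollary 1.2 of the paper (flat case): uniform upper bound on compact subsets
given a positive lower bound `inf_Ω u ≥ m`. -/
theorem sup_bound_of_inf_bound (Ω : Set (EuclideanSpace ℝ (Fin 4))) (hΩ : IsOpen Ω)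
    (K : Set (EuclideanSpace ℝ (Fin 4))) (hK : IsCompact K) (hKΩ : K ⊆ Ω)
    (A m : ℝ) (hA : 0 < A) (hm : 0 < m) :
    ∃ c > 0, ∀ h u : EuclideanSpace ℝ (Fin 4) → ℝ,
      Measurable h → (∀ x ∈ Ω, |h x| ≤ A) →
      ContDiffOn ℝ 2 u Ω → (∀ x ∈ Ω, 0 < u x) →
      (∀ x ∈ Ω, -lap u x + h x * u x = 8 * (u x) ^ 3) →
      m ≤ sInf (u '' Ω) →
      sSup (u '' K) ≤ c := by
  obtain ⟨δ, hδ, hδΩ⟩ := hK.exists_cthickening_subset_open hΩ hKΩ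
  obtain ⟨ρ, hρ, hρδ, hAρ, hρm⟩ : ∃ ρ > 0, ρ ≤ δ / 3 ∧ A * ρ ^ 2 ≤ 1 ∧ 24 * A * ρ ≤ m / 2 := by
    have h0 : Tendsto (fun ρ : ℝ => ρ) (𝓝[>] 0) (𝓝 0) := tendsto_id.mono_left nhdsWithin_le_nhds
    have h1 : Tendsto (fun ρ : ℝ => A * ρ ^ 2) (𝓝[>] 0) (𝓝 0) := by
      simpa using (h0.pow 2).const_mul A
    have h2 : Tendsto (fun ρ : ℝ => 24 * A * ρ) (𝓝[>] 0) (𝓝 0) := by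
      simpa using h0.const_mul (24 * A)
    have h3 : ∀ᶠ ρ : ℝ in 𝓝[>] 0, 0 < ρ := self_mem_nhdsWithin
    obtain ⟨ρ, a, b, c, d⟩ := (h3.and ((h0.eventually_le_const
      (by positivity : 0 < δ / 3)).and ((h1.eventually_le_const one_pos).and
      (h2.eventually_le_const (by positivity : 0 < m / 2))))).exists
    exact ⟨ρ, a, b, c, d⟩
  have hc : 0 < 24 / ρ + 144 / (m * ρ ^ 2) + 4 * A + 1 := by positivity
  refine ⟨_, hc, fun h u _ hh hu hpos heq hinf => Real.sSup_le ?_ hc.le⟩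
  rintro _ ⟨p, hp, rfl⟩
  have hum : ∀ z ∈ Ω, m ≤ u z := fun z hz => hinf.trans <|
    csInf_le ⟨0, by rintro _ ⟨w, hw, rfl⟩; exact (hpos w hw).le⟩ ⟨z, hz, rfl⟩
  refine le_of_closedBall_subset hΩ hA hm (R := δ / 3) (by positivity) hρ hρδ ?_ hh hu heq hum
    hAρ hρm
  rw [mul_div_cancel₀ δ (by norm_num : (3 : ℝ) ≠ 0)]
  exact (closedBall_subset_cthickening hp δ).trans hδΩ
end
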